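/- Let α be an irrational real number, and let p_n denote the n-th prime. Then the sequence {α·p_n} is uniformly distributed modulo 1. -/

import Mathlib

open Filter

/-- `x` has leading digit `d` in base 10: `d·10^k ≤ x < (d+1)·10^k` for some integer `k`. -/
def HasLeadingDigit (x : ℝ) (d : ℕ) : Prop :=
  ∃ k : ℤ, (d : ℝ) * 10 ^ k ≤ x ∧ x < ((d : ℝ) + 1) * 10 ^ k

/-- The Benford frequency `P(d) = log₁₀ (1 + 1/d)` of digit `d`. -/
noncomputable def benfordP (d : ℕ) : ℝ := Real.logb 10 (1 + 1 / (d : ℝ))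

/-- A sequence is Benford distributed if for each digit `d ∈ {1,…,9}` the density of
indices `n` with `D(a_n) = d` equals `P(d)`. -/
def BenfordDistributed (a : ℕ → ℝ) : Prop :=
  ∀ d : ℕ, 1 ≤ d → d ≤ 9 →
    Tendsto
      (fun N : ℕ =>
        (Nat.card {n : ℕ | 1 ≤ n ∧ n ≤ N ∧ HasLeadingDigit (a n) d} : ℝ) / N)
      atTop (nhds (benfordP d))

/-- A sequence is locally Benford distributed of order `k` if every `k`-tuple of digits
in `{1,…,9}` occurs among leading digits of `k` consecutive terms with density
`P(d₀)⋯P(d_{k-1})`. -/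
def LocallyBenfordDistributed (a : ℕ → ℝ) (k : ℕ) : Prop :=
  ∀ d : Fin k → ℕ, (∀ i, 1 ≤ d i ∧ d i ≤ 9) →
    Tendsto
      (fun N : ℕ =>
        (Nat.card {n : ℕ | 1 ≤ n ∧ n ≤ N ∧
            ∀ i : Fin k, HasLeadingDigit (a (n + (i : ℕ))) (d i)} : ℝ) / N)
      atTop (nhds (∏ i : Fin k, benfordP (d i)))

/-- `waitingTime a d i` is the waiting time `w_i(d) = n_{i+1}^{(d)} - n_i^{(d)}`, where
`n_1^{(d)} < n_2^{(d)} < ⋯` enumerates `{n ∈ ℕ, n ≥ 1 : D(a_n) = d}`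
(the `j`-th element of this set, 1-indexed, being `Nat.nth · (j-1)`). -/
noncomputable def waitingTime (a : ℕ → ℝ) (d : ℕ) (i : ℕ) : ℕ :=
  Nat.nth (fun n => 1 ≤ n ∧ HasLeadingDigit (a n) d) i -
    Nat.nth (fun n => 1 ≤ n ∧ HasLeadingDigit (a n) d) (i - 1)

/-- A sequence has Benford distributed waiting times if for each digit `d ∈ {1,…,9}`
the waiting times between occurrences of leading digit `d` take value `k` with density
`P(d)(1-P(d))^{k-1}`. -/
def BenfordWaitingTimes (a : ℕ → ℝ) : Prop :=
  ∀ d : ℕ, 1 ≤ d → d ≤ 9 → ∀ k : ℕ, 1 ≤ k →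
    Tendsto
      (fun N : ℕ =>
        (Nat.card {i : ℕ | 1 ≤ i ∧ i ≤ N ∧ waitingTime a d i = k} : ℝ) / N)
      atTop (nhds (benfordP d * (1 - benfordP d) ^ (k - 1)))

/-- A sequence `u` of real numbers is uniformly distributed modulo 1. -/
def UniformlyDistributedMod1 (u : ℕ → ℝ) : Prop :=
  ∀ t : ℝ, 0 ≤ t → t ≤ 1 →
    Tendsto
      (fun N : ℕ =>
        (Nat.card {n : ℕ | 1 ≤ n ∧ n ≤ N ∧ Int.fract (u n) ≤ t} : ℝ) / N)
      atTop (nhds t)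

/-- `nthPrime n` is the `n`-th prime (1-indexed): `nthPrime 1 = 2`, `nthPrime 2 = 3`, … -/
noncomputable def nthPrime (n : ℕ) : ℕ := Nat.nth Nat.Prime (n - 1)

section VinoProof
open Finset

/-- double-log class of an integer -/
def vcls (p : ℕ) : ℕ := Nat.log 2 (Nat.log 2 p)

/-- primes of class `j` -/
def vP (j : ℕ) : Finset ℕ := (range (2 ^ (2 ^ (j + 1)))).filter (fun p => p.Prime ∧ vcls p = j)

lemma vP_prime {j p : ℕ} (h : p ∈ vP j) : p.Prime := by
  simp only [vP, mem_filter] at h; exact h.2.1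

lemma vP_cls {j p : ℕ} (h : p ∈ vP j) : vcls p = j := by
  simp only [vP, mem_filter] at h; exact h.2.2

lemma vP_lt {j p : ℕ} (h : p ∈ vP j) : p < 2 ^ (2 ^ (j + 1)) := by
  simp only [vP, mem_filter, mem_range] at h; exact h.1

lemma vlog_pos {p : ℕ} (h : p.Prime) : Nat.log 2 p ≠ 0 := by
  have := Nat.log_pos (b := 2) (by norm_num) h.two_le
  omega

lemma vP_ge {j p : ℕ} (h : p ∈ vP j) : 2 ^ (2 ^ j) ≤ p := by
  have hp := vP_prime h
  have h1 := vP_cls h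
  unfold vcls at h1
  have h2 : 2 ^ j ≤ Nat.log 2 p := by
    rw [← h1]; exact Nat.pow_log_le_self 2 (vlog_pos hp)
  calc 2 ^ (2 ^ j) ≤ 2 ^ (Nat.log 2 p) := Nat.pow_le_pow_right (by norm_num) h2
    _ ≤ p := Nat.pow_log_le_self 2 hp.ne_zero

lemma vcls_lt {p J : ℕ} (hp : p.Prime) (h : p < 2 ^ (2 ^ J)) : vcls p < J := by
  unfold vcls
  apply Nat.log_lt_of_lt_pow (vlog_pos hp)
  exact Nat.log_lt_of_lt_pow hp.ne_zero h

lemma vP_mem {p : ℕ} (hp : p.Prime) : p ∈ vP (vcls p) := by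
  simp only [vP, mem_filter, mem_range, hp, and_true]
  have h1 : Nat.log 2 p < 2 ^ (vcls p + 1) := Nat.lt_pow_succ_log_self (by norm_num) _
  calc p < 2 ^ (Nat.log 2 p + 1) := Nat.lt_pow_succ_log_self (by norm_num) _
    _ ≤ 2 ^ (2 ^ (vcls p + 1)) := Nat.pow_le_pow_right (by norm_num) h1

/-- Chebyshev: number of primes in a dyadic block -/
lemma v_dyadic (k : ℕ) :
    (((Ico (2 ^ k) (2 ^ (k + 1))).filter Nat.Prime).card : ℝ) * k ≤ 4 * 2 ^ k := by
  have h1 := Chebyshev.theta_le_log4_mul_x (x := (2 : ℝ) ^ (k + 1)) (by positivity)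
  have hl2 : 0 < Real.log 2 := Real.log_pos (by norm_num)
  have h4 : Real.log 4 = 2 * Real.log 2 := by
    rw [show (4 : ℝ) = 2 ^ 2 by norm_num, Real.log_pow]; norm_num
  have h2 : (((Ico (2 ^ k) (2 ^ (k + 1))).filter Nat.Prime).card : ℝ) * (k * Real.log 2) ≤
      Chebyshev.theta ((2 : ℝ) ^ (k + 1)) := by
    unfold Chebyshev.theta
    have hf : ⌊(2 : ℝ) ^ (k + 1)⌋₊ = 2 ^ (k + 1) := by
      rw [show (2 : ℝ) ^ (k + 1) = ((2 ^ (k + 1) : ℕ) : ℝ) by push_cast; rfl, Nat.floor_natCast]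
    rw [hf, ← nsmul_eq_mul, ← Finset.sum_const]
    calc ∑ x ∈ (Ico (2 ^ k) (2 ^ (k + 1))).filter Nat.Prime, (k * Real.log 2)
        ≤ ∑ x ∈ (Ico (2 ^ k) (2 ^ (k + 1))).filter Nat.Prime, Real.log x := by
          apply Finset.sum_le_sum
          intro p hp
          simp only [mem_filter, mem_Ico] at hp
          rw [← Real.log_pow]
          apply Real.log_le_log (by positivity)
          exact_mod_cast hp.1.1
      _ ≤ _ := by
          apply Finset.sum_le_sum_of_subset_of_nonneg
          · intro p hp
            simp only [mem_filter, mem_Ico, mem_Ioc] at hp ⊢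
            exact ⟨⟨hp.2.pos, hp.1.2.le⟩, hp.2⟩
          · intro p hp _
            simp only [mem_filter, mem_Ioc] at hp
            exact Real.log_nonneg (by exact_mod_cast hp.1.1)
  have h3 := h2.trans h1
  rw [h4] at h3
  have : (((Ico (2 ^ k) (2 ^ (k + 1))).filter Nat.Prime).card : ℝ) * k * Real.log 2 ≤ (4 * 2 ^ k) * Real.log 2 := by
    rw [pow_succ (2 : ℝ) k] at h3
    linarith
  exact le_of_mul_le_mul_right this hl2

lemma vP_sum_inv (j : ℕ) : ∑ p ∈ vP j, (1 / (p : ℝ)) ≤ 4 := by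
  have hsub : vP j ⊆ (Ico (2 ^ j) (2 ^ (j + 1))).biUnion
      (fun k => (Ico (2 ^ k) (2 ^ (k + 1))).filter Nat.Prime) := by
    intro p hp
    have hpp := vP_prime hp
    simp only [mem_biUnion, mem_filter, mem_Ico]
    refine ⟨Nat.log 2 p, ⟨?_, ?_⟩, ⟨Nat.pow_log_le_self 2 hpp.ne_zero,
      Nat.lt_pow_succ_log_self (by norm_num) _⟩, hpp⟩
    · exact Nat.le_log_of_pow_le (by norm_num) (vP_ge hp)
    · exact Nat.log_lt_of_lt_pow hpp.ne_zero (vP_lt hp)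
  calc ∑ p ∈ vP j, (1 / (p : ℝ))
      ≤ ∑ p ∈ (Ico (2 ^ j) (2 ^ (j + 1))).biUnion
        (fun k => (Ico (2 ^ k) (2 ^ (k + 1))).filter Nat.Prime), (1 / (p : ℝ)) :=
        Finset.sum_le_sum_of_subset_of_nonneg hsub (fun _ _ _ => by positivity)
    _ ≤ ∑ k ∈ Ico (2 ^ j) (2 ^ (j + 1)), ∑ p ∈ (Ico (2 ^ k) (2 ^ (k + 1))).filter Nat.Prime, (1 / (p : ℝ)) := by
        rw [Finset.sum_biUnion]
        intro a _ b _ hab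
        rw [Function.onFun, Finset.disjoint_left]
        intro p hp hp'
        simp only [mem_filter, mem_Ico] at hp hp'
        apply hab
        have h1 := (Nat.log_eq_iff (b := 2) (m := a) (n := p) (Or.inr ⟨by norm_num, hp.2.ne_zero⟩)).2 hp.1
        have h2 := (Nat.log_eq_iff (b := 2) (m := b) (n := p) (Or.inr ⟨by norm_num, hp.2.ne_zero⟩)).2 hp'.1
        rw [← h1, ← h2]
    _ ≤ ∑ k ∈ Ico (2 ^ j) (2 ^ (j + 1)), (4 / 2 ^ j : ℝ) := by
        apply Finset.sum_le_sum
        intro k hk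
        simp only [mem_Ico] at hk
        have hk0 : (0 : ℝ) < 2 ^ j := by positivity
        have hk1 : (2 ^ j : ℝ) ≤ k := by exact_mod_cast hk.1
        calc ∑ p ∈ (Ico (2 ^ k) (2 ^ (k + 1))).filter Nat.Prime, (1 / (p : ℝ))
            ≤ ∑ p ∈ (Ico (2 ^ k) (2 ^ (k + 1))).filter Nat.Prime, (1 / (2 : ℝ) ^ k) := by
              apply Finset.sum_le_sum
              intro p hp
              simp only [mem_filter, mem_Ico] at hp
              apply one_div_le_one_div_of_le (by positivity)
              exact_mod_cast hp.1.1
          _ = (((Ico (2 ^ k) (2 ^ (k + 1))).filter Nat.Prime).card : ℝ) / 2 ^ k := by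
              rw [Finset.sum_const, nsmul_eq_mul]; ring
          _ ≤ 4 / k := by
              rw [div_le_div_iff₀ (by positivity) (by linarith)]
              exact v_dyadic k
          _ ≤ 4 / 2 ^ j := by
              apply div_le_div_of_nonneg_left (by norm_num) hk0 hk1
    _ = 4 := by
        rw [Finset.sum_const, Nat.card_Ico, nsmul_eq_mul]
        have : 2 ^ (j + 1) - 2 ^ j = 2 ^ j := by rw [pow_succ]; omega
        rw [this]
        push_cast
        field_simp

/-- Mertens-type upper bound for the sieve product -/
lemma v_euler (J : ℕ) :
    ∏ j : Fin J, ∏ p ∈ vP j, (1 - 1 / (p : ℝ)) ≤ 2 / 2 ^ J := by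
  have key : ((2 : ℝ) ^ J) / 2 ≤ ∏ p ∈ Nat.primesBelow (2 ^ (2 ^ J)), (1 - 1 / (p : ℝ))⁻¹ := by
    let f : ℕ →* ℝ := { toFun := fun n => (n : ℝ)⁻¹, map_one' := by simp, map_mul' := by
                          intro a b; push_cast; rw [mul_inv] }
    have hf : ∀ {p : ℕ}, p.Prime → ‖f p‖ < 1 := by
      intro p hp
      simp only [f, MonoidHom.coe_mk, OneHom.coe_mk, norm_inv, RCLike.norm_natCast]
      exact inv_lt_one_of_one_lt₀ (by exact_mod_cast hp.one_lt)
    have h := (EulerProduct.summable_and_hasSum_smoothNumbers_prod_primesBelow_geometric hf (2 ^ (2 ^ J)))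
    have h1 : ∏ p ∈ Nat.primesBelow (2 ^ (2 ^ J)), (1 - 1 / (p : ℝ))⁻¹ =
       ∏ p ∈ Nat.primesBelow (2 ^ (2 ^ J)), (1 - f p)⁻¹ := by
      apply Finset.prod_congr rfl; intro p _; simp [f]
    rw [h1]
    have h2 : ∑ n ∈ Ico (1 : ℕ) (2 ^ (2 ^ J)), ((n : ℝ)⁻¹) ≤ ∏ p ∈ Nat.primesBelow (2 ^ (2 ^ J)), (1 - f p)⁻¹ := by
      have hs : ∀ n ∈ Ico 1 (2 ^ (2 ^ J)), n ∈ Nat.smoothNumbers (2 ^ (2 ^ J)) := by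
        intro n hn
        simp only [mem_Ico] at hn
        exact Nat.mem_smoothNumbers_of_lt (by omega) hn.2
      have h3 := sum_le_hasSum ((Ico 1 (2 ^ (2 ^ J))).subtype (fun n => n ∈ Nat.smoothNumbers (2 ^ (2 ^ J))))
        (fun i _ => by simp [f]) h.2
      refine le_trans (le_of_eq ?_) h3
      rw [Finset.sum_subtype_of_mem (f := fun n => f n) hs]
      rfl
    refine le_trans ?_ h2
    have h4 : ∀ K : ℕ, (K : ℝ) / 2 ≤ ∑ n ∈ Ico (1 : ℕ) (2 ^ K), ((n : ℝ)⁻¹) := by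
      intro K
      induction K with
      | zero => simp
      | succ K ih =>
        rw [← Finset.sum_Ico_consecutive _ (Nat.one_le_two_pow (n := K)) (Nat.pow_le_pow_right (by norm_num) (Nat.le_succ K))]
        have : (1 : ℝ) / 2 ≤ ∑ n ∈ Ico (2 ^ K : ℕ) (2 ^ (K + 1)), ((n : ℝ)⁻¹) := by
          calc (1 : ℝ) / 2 = ∑ n ∈ Ico (2 ^ K : ℕ) (2 ^ (K + 1)), ((2 : ℝ) ^ (K + 1))⁻¹ := by
                rw [Finset.sum_const, Nat.card_Ico, nsmul_eq_mul]
                have : 2 ^ (K + 1) - 2 ^ K = 2 ^ K := by rw [pow_succ]; omega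
                rw [this]
                push_cast
                rw [pow_succ]
                field_simp
            _ ≤ _ := by
                apply Finset.sum_le_sum
                intro n hn
                simp only [mem_Ico] at hn
                have h0 : 0 < n := lt_of_lt_of_le (by positivity) hn.1
                apply inv_anti₀ (by exact_mod_cast h0)
                exact_mod_cast hn.2.le
        push_cast
        linarith
    have := h4 (2 ^ J)
    push_cast at this
    exact this
  have hpr : ∏ j : Fin J, ∏ p ∈ vP j, (1 - 1 / (p : ℝ)) = ∏ p ∈ Nat.primesBelow (2 ^ (2 ^ J)), (1 - 1 / (p : ℝ)) := by
    rw [Fin.prod_univ_eq_prod_range (fun j => ∏ p ∈ vP j, (1 - 1 / (p : ℝ))) J]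
    rw [← Finset.prod_biUnion]
    · apply Finset.prod_congr _ (fun _ _ => rfl)
      ext p
      simp only [mem_biUnion, mem_range, Nat.mem_primesBelow]
      constructor
      · rintro ⟨j, hj, hp⟩
        refine ⟨lt_of_lt_of_le (vP_lt hp) ?_, vP_prime hp⟩
        exact Nat.pow_le_pow_right (by norm_num) (Nat.pow_le_pow_right (by norm_num) hj)
      · rintro ⟨h1, h2⟩
        exact ⟨_, vcls_lt h2 h1, vP_mem h2⟩
    · intro a _ b _ hab
      rw [Function.onFun, Finset.disjoint_left]
      intro p hp hp'
      exact hab (by rw [← vP_cls hp, ← vP_cls hp'])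
  rw [hpr]
  rw [Finset.prod_inv_distrib] at key
  have h2 : (2 : ℝ) / 2 ^ J = (2 ^ J / 2)⁻¹ := by rw [inv_div]
  rw [h2]
  have h3 := inv_anti₀ (by positivity) key
  rwa [inv_inv] at h3


def vT (j R : ℕ) : Finset (Finset ℕ) := (vP j).powerset.filter (fun T => T.card ≤ R)

noncomputable def vind (T : Finset ℕ) (m : ℕ) : ℝ := if ∀ p ∈ T, p ∣ m then 1 else 0

noncomputable def vF {J : ℕ} (R : Fin J → ℕ) (c : Fin J → Finset ℕ → ℝ) (m : ℕ) : ℝ :=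
  ∏ j : Fin J, ∑ T ∈ vT j (R j), c j T * vind T m

def vd {J : ℕ} (τ : Fin J → Finset ℕ) : ℕ := ∏ j, ∏ p ∈ τ j, p

def vOm {J : ℕ} (R : Fin J → ℕ) : Finset (Fin J → Finset ℕ) :=
  Fintype.piFinset (fun j => vT j (R j))

def vD {J : ℕ} (R : Fin J → ℕ) : ℕ := ∏ j : Fin J, (2 ^ (2 ^ ((j : ℕ) + 1))) ^ (R j)

noncomputable def vmean (j R : ℕ) (c : Finset ℕ → ℝ) : ℝ :=
  ∑ T ∈ vT j R, c T * ∏ p ∈ T, (1 / (p : ℝ))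

lemma vT_prime {j R : ℕ} {T : Finset ℕ} (h : T ∈ vT j R) : ∀ p ∈ T, p.Prime := by
  simp only [vT, mem_filter, mem_powerset] at h
  exact fun p hp => vP_prime (h.1 hp)

lemma vT_sub {j R : ℕ} {T : Finset ℕ} (h : T ∈ vT j R) : T ⊆ vP j := by
  simp only [vT, mem_filter, mem_powerset] at h
  exact h.1

lemma vT_card {j R : ℕ} {T : Finset ℕ} (h : T ∈ vT j R) : T.card ≤ R := by
  simp only [vT, mem_filter, mem_powerset] at h
  exact h.2

lemma vOm_mem {J : ℕ} {R : Fin J → ℕ} {τ : Fin J → Finset ℕ} (h : τ ∈ vOm R) (j : Fin J) :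
    τ j ∈ vT j (R j) := by
  simp only [vOm, Fintype.mem_piFinset] at h; exact h j

lemma vT_prod_le {j R : ℕ} {T : Finset ℕ} (h : T ∈ vT j R) :
    ∏ p ∈ T, p ≤ (2 ^ (2 ^ (j + 1))) ^ R := by
  calc ∏ p ∈ T, p ≤ (2 ^ (2 ^ (j + 1))) ^ T.card :=
        Finset.prod_le_pow_card _ _ _ (fun p hp => (vP_lt (vT_sub h hp)).le)
    _ ≤ _ := Nat.pow_le_pow_right (by positivity) (vT_card h)

lemma vT_card_le (j R : ℕ) : (vT j R).card ≤ (2 ^ (2 ^ (j + 1))) ^ R := by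
  have : (vT j R).card ≤ (Ioc 0 ((2 ^ (2 ^ (j + 1))) ^ R)).card := by
    apply Finset.card_le_card_of_injOn (fun T => ∏ p ∈ T, p)
    · intro T hT
      simp only [coe_Ioc, Set.mem_Ioc]
      refine ⟨Finset.prod_pos (fun p hp => (vT_prime hT p hp).pos), vT_prod_le hT⟩
    · intro T hT T' hT' h
      simp only at h
      rw [← Nat.primeFactors_prod (vT_prime hT), h, Nat.primeFactors_prod (vT_prime hT')]
  simpa using this

lemma vOm_card_le {J : ℕ} (R : Fin J → ℕ) : (vOm R).card ≤ vD R := by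
  rw [vOm, Fintype.card_piFinset]
  exact Finset.prod_le_prod' (fun j _ => vT_card_le j (R j))

lemma vd_le {J : ℕ} {R : Fin J → ℕ} {τ : Fin J → Finset ℕ} (h : τ ∈ vOm R) : vd τ ≤ vD R :=
  Finset.prod_le_prod' (fun j _ => vT_prod_le (vOm_mem h j))

lemma vd_pos {J : ℕ} {R : Fin J → ℕ} {τ : Fin J → Finset ℕ} (h : τ ∈ vOm R) : 0 < vd τ :=
  Finset.prod_pos (fun j _ => Finset.prod_pos (fun p hp => (vT_prime (vOm_mem h j) p hp).pos))

lemma vd_eq {J : ℕ} {R : Fin J → ℕ} {τ : Fin J → Finset ℕ} (h : τ ∈ vOm R) :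
    vd τ = ∏ p ∈ univ.biUnion τ, p := by
  rw [Finset.prod_biUnion]
  · rfl
  · intro a _ b _ hab
    rw [Function.onFun, Finset.disjoint_left]
    intro p hp hp'
    apply hab
    apply Fin.ext
    rw [← vP_cls (vT_sub (vOm_mem h a) hp), ← vP_cls (vT_sub (vOm_mem h b) hp')]

lemma vU_prime {J : ℕ} {R : Fin J → ℕ} {τ : Fin J → Finset ℕ} (h : τ ∈ vOm R) :
    ∀ p ∈ univ.biUnion τ, p.Prime := by
  intro p hp
  simp only [mem_biUnion, mem_univ, true_and] at hp
  obtain ⟨j, hj⟩ := hp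
  exact vT_prime (vOm_mem h j) p hj

lemma vd_dvd {J : ℕ} {R : Fin J → ℕ} {τ : Fin J → Finset ℕ} (h : τ ∈ vOm R) (m : ℕ) :
    vd τ ∣ m ↔ ∀ j, ∀ p ∈ τ j, p ∣ m := by
  rw [vd_eq h]
  constructor
  · intro hd j p hp
    exact (Finset.dvd_prod_of_mem (fun p => p) (by simp only [mem_biUnion, mem_univ, true_and]; exact ⟨j, hp⟩)).trans hd
  · intro hd
    apply Finset.prod_primes_dvd
    · intro p hp
      exact (vU_prime h p hp).prime
    · intro p hp
      simp only [mem_biUnion, mem_univ, true_and] at hp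
      obtain ⟨j, hj⟩ := hp
      exact hd j p hj

/-- prime divisors of vd -/
lemma vd_prime_dvd {J : ℕ} {R : Fin J → ℕ} {τ : Fin J → Finset ℕ} (h : τ ∈ vOm R) {l : ℕ}
    (hl : l.Prime) : l ∣ vd τ ↔ ∃ j, l ∈ τ j := by
  rw [vd_eq h]
  constructor
  · intro hd
    have : l ∈ (∏ p ∈ univ.biUnion τ, p).primeFactors := by
      rw [Nat.mem_primeFactors]
      refine ⟨hl, hd, ?_⟩
      rw [← vd_eq h]; exact (vd_pos h).ne'
    rw [Nat.primeFactors_prod (vU_prime h)] at this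
    simpa using this
  · rintro ⟨j, hj⟩
    exact Finset.dvd_prod_of_mem (fun p => p) (by simp only [mem_biUnion, mem_univ, true_and]; exact ⟨j, hj⟩)

lemma vd_squarefree {J : ℕ} {R : Fin J → ℕ} {τ : Fin J → Finset ℕ} (h : τ ∈ vOm R) :
    Squarefree (vd τ) := by
  rw [vd_eq h]
  rw [Nat.squarefree_iff_prime_squarefree]
  intro x hx hd
  have hx' : x ∈ (∏ p ∈ univ.biUnion τ, p).primeFactors := by
    rw [Nat.mem_primeFactors]
    refine ⟨hx, (dvd_mul_right x x).trans hd, ?_⟩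
    rw [← vd_eq h]; exact (vd_pos h).ne'
  rw [Nat.primeFactors_prod (vU_prime h)] at hx'
  rw [← Finset.mul_prod_erase _ _ hx'] at hd
  have h2 : x ∣ ∏ p ∈ (univ.biUnion τ).erase x, p := Nat.dvd_of_mul_dvd_mul_left hx.pos hd
  rw [hx.prime.dvd_finsetProd_iff] at h2
  obtain ⟨p, hp, hxp⟩ := h2
  rw [mem_erase] at hp
  exact hp.1 ((Nat.prime_dvd_prime_iff_eq hx (vU_prime h p hp.2)).1 hxp).symm

lemma vF_eq {J : ℕ} (R : Fin J → ℕ) (c : Fin J → Finset ℕ → ℝ) (m : ℕ) :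
    vF R c m = ∑ τ ∈ vOm R, (∏ j, c j (τ j)) * (if vd τ ∣ m then 1 else 0) := by
  unfold vF
  rw [Finset.prod_univ_sum]
  apply Finset.sum_congr rfl
  intro τ hτ
  rw [Finset.prod_mul_distrib]
  congr 1
  by_cases h : vd τ ∣ m
  · rw [if_pos h]
    apply Finset.prod_eq_one
    intro j _
    rw [vind, if_pos ((vd_dvd hτ m).1 h j)]
  · rw [if_neg h]
    have h' := h
    rw [vd_dvd hτ] at h'
    push Not at h'
    obtain ⟨j, p, hp, hpm⟩ := h'
    apply Finset.prod_eq_zero (mem_univ j)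
    rw [vind, if_neg]
    intro h2; exact hpm (h2 p hp)

lemma vmean_eq {J : ℕ} (R : Fin J → ℕ) (c : Fin J → Finset ℕ → ℝ) :
    ∏ j : Fin J, vmean j (R j) (c j) = ∑ τ ∈ vOm R, (∏ j, c j (τ j)) * (1 / (vd τ : ℝ)) := by
  unfold vmean
  rw [Finset.prod_univ_sum]
  apply Finset.sum_congr rfl
  intro τ hτ
  rw [Finset.prod_mul_distrib]
  congr 1
  unfold vd
  push_cast
  simp

lemma v_absprod {J : ℕ} {c : Fin J → Finset ℕ → ℝ}
    (hc : ∀ j, ∀ T, |c j T| ≤ 1) (τ : Fin J → Finset ℕ) : |∏ j, c j (τ j)| ≤ 1 := by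
  rw [Finset.abs_prod]
  exact Finset.prod_le_one (fun _ _ => abs_nonneg _) (fun j _ => hc j _)

lemma v_mass {J : ℕ} (R : Fin J → ℕ) (c : Fin J → Finset ℕ → ℝ)
    (hc : ∀ j, ∀ T, |c j T| ≤ 1) (M : ℕ) :
    ∑ m ∈ Ioc 0 M, vF R c m ≤ M * ∏ j : Fin J, vmean j (R j) (c j) + vD R := by
  have h1 : ∑ m ∈ Ioc 0 M, vF R c m =
      ∑ τ ∈ vOm R, (∏ j, c j (τ j)) * ((M / vd τ : ℕ) : ℝ) := by
    simp_rw [vF_eq]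
    rw [Finset.sum_comm]
    apply Finset.sum_congr rfl
    intro τ _
    rw [← Finset.mul_sum, Finset.sum_boole, Nat.Ioc_filter_dvd_card_eq_div]
  rw [h1, vmean_eq, Finset.mul_sum]
  have h2 : ∑ τ ∈ vOm R, (∏ j, c j (τ j)) * ((M / vd τ : ℕ) : ℝ) ≤
     ∑ τ ∈ vOm R, (M * ((∏ j, c j (τ j)) * (1 / (vd τ : ℝ))) + 1) := by
    apply Finset.sum_le_sum
    intro τ hτ
    have hd : (0 : ℝ) < vd τ := by exact_mod_cast vd_pos hτ
    have ha := v_absprod hc τ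
    have hb : |((M / vd τ : ℕ) : ℝ) - M / vd τ| ≤ 1 := by
      have e1 : ((M / vd τ : ℕ) : ℝ) ≤ M / vd τ := Nat.cast_div_le
      have e2 : (M : ℝ) / vd τ < ((M / vd τ : ℕ) : ℝ) + 1 := by
        rw [div_lt_iff₀ hd]
        have := Nat.lt_mul_div_succ M (vd_pos hτ)
        have h3 : (M : ℝ) < (vd τ : ℝ) * (((M / vd τ : ℕ) : ℝ) + 1) := by exact_mod_cast this
        linarith
      rw [abs_le]; constructor <;> linarith
    have hm : |(∏ j, c j (τ j)) * (((M / vd τ : ℕ) : ℝ) - M / vd τ)| ≤ 1 := by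
      rw [abs_mul]
      exact mul_le_one₀ ha (abs_nonneg _) hb
    have := (abs_le.1 hm).2
    have e3 : (M : ℝ) * ((∏ j, c j (τ j)) * (1 / (vd τ : ℝ))) = (∏ j, c j (τ j)) * (M / vd τ) := by ring
    rw [e3]
    linarith
  refine h2.trans ?_
  rw [Finset.sum_add_distrib, Finset.sum_const, nsmul_eq_mul, mul_one]
  have : ((vOm R).card : ℝ) ≤ vD R := by exact_mod_cast vOm_card_le R
  linarith


noncomputable def vcy (r : ℕ) (T : Finset ℕ) : ℝ := if T.card ≤ r then (-1) ^ T.card else 0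
noncomputable def vct (r : ℕ) (T : Finset ℕ) : ℝ := if T.card = r + 1 then 1 else 0

lemma v_sum_ind (j r m : ℕ) (f : ℕ → ℝ) (hf : ∀ i, r + 1 < i → f i = 0) :
    ∑ T ∈ vT j (r + 1), f T.card * vind T m =
      ∑ i ∈ range (((vP j).filter (· ∣ m)).card + 1), (((vP j).filter (· ∣ m)).card.choose i) • f i := by
  rw [← Finset.sum_powerset_apply_card]
  have h1 : ∑ T ∈ vT j (r + 1), f T.card * vind T m = ∑ T ∈ (vP j).powerset, f T.card * vind T m := by
    unfold vT
    apply Finset.sum_filter_of_ne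
    intro T _ hne
    by_contra hc
    push Not at hc
    rw [hf _ hc, zero_mul] at hne
    exact hne rfl
  rw [h1]
  have h2 : ((vP j).filter (· ∣ m)).powerset = (vP j).powerset.filter (fun T => ∀ p ∈ T, p ∣ m) := by
    ext T
    simp only [mem_powerset, mem_filter, Finset.subset_iff]
    constructor
    · intro h; exact ⟨fun x hx => (h hx).1, fun x hx => (h hx).2⟩
    · intro h x hx; exact ⟨h.1 hx, h.2 x hx⟩
  rw [h2, Finset.sum_filter]
  apply Finset.sum_congr rfl
  intro T _
  unfold vind
  split_ifs <;> simp

lemma v_y_eq (j r m : ℕ) (hr : Even r) :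
    ∑ T ∈ vT j (r + 1), vcy r T * vind T m =
      if ((vP j).filter (· ∣ m)).card = 0 then 1 else ((((vP j).filter (· ∣ m)).card - 1).choose r : ℝ) := by
  have := v_sum_ind j r m (fun i => if i ≤ r then (-1) ^ i else 0) (by intro i hi; exact if_neg (by omega))
  unfold vcy
  rw [this]
  generalize ((vP j).filter (· ∣ m)).card = n
  have h1 : ∑ i ∈ range (n + 1), (n.choose i) • (if i ≤ r then (-1 : ℝ) ^ i else 0) =
      ∑ i ∈ range (r + 1), (-1 : ℝ) ^ i * (n.choose i) := by
    have e1 : ∑ i ∈ range (n + 1), (n.choose i) • (if i ≤ r then (-1 : ℝ) ^ i else 0) =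
      ∑ i ∈ range (n + r + 1), (n.choose i) • (if i ≤ r then (-1 : ℝ) ^ i else 0) := by
      apply Finset.sum_subset
      · intro x hx; simp only [mem_range] at *; omega
      · intro x _ hx
        simp only [mem_range] at hx
        rw [Nat.choose_eq_zero_of_lt (by omega), zero_smul]
    rw [e1]
    symm
    have e2 : ∑ i ∈ range (r + 1), (-1 : ℝ) ^ i * (n.choose i) =
       ∑ i ∈ range (r + 1), (n.choose i) • (if i ≤ r then (-1 : ℝ) ^ i else 0) := by
      apply Finset.sum_congr rfl
      intro i hi
      simp only [mem_range] at hi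
      rw [if_pos (by omega), nsmul_eq_mul]; ring
    rw [e2]
    apply Finset.sum_subset
    · intro x hx; simp only [mem_range] at *; omega
    · intro x _ hx
      simp only [mem_range] at hx
      rw [if_neg (by omega), smul_zero]
  rw [h1]
  rcases n with _ | n
  · simp only [if_true]
    rw [Finset.sum_range_succ']
    simp
  · rw [if_neg (by omega)]
    have h := @Int.alternating_sum_range_choose_eq_choose n r
    have h' : ((∑ k ∈ range (r + 1), (-1) ^ k * ((n + 1).choose k : ℤ) : ℤ) : ℝ) = (((-1) ^ r * (n.choose r : ℤ) : ℤ) : ℝ) := by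
      rw [h]
    push_cast at h'
    rw [h', hr.neg_one_pow]
    simp

lemma v_t_eq (j r m : ℕ) :
    ∑ T ∈ vT j (r + 1), vct r T * vind T m = (((vP j).filter (· ∣ m)).card.choose (r + 1) : ℝ) := by
  have := v_sum_ind j r m (fun i => if i = r + 1 then 1 else 0) (by intro i hi; exact if_neg (by omega))
  unfold vct
  rw [this]
  generalize ((vP j).filter (· ∣ m)).card = n
  simp only [smul_ite, nsmul_eq_mul, mul_one, smul_zero, Finset.sum_ite_eq', mem_range]
  split_ifs with h
  · simp
  · rw [Nat.choose_eq_zero_of_lt (by omega)]; simp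

noncomputable def vx (j m : ℕ) : ℝ := if ((vP j).filter (· ∣ m)).card = 0 then 1 else 0

lemma v_y_nonneg (j r m : ℕ) (hr : Even r) : 0 ≤ ∑ T ∈ vT j (r + 1), vcy r T * vind T m := by
  rw [v_y_eq j r m hr]
  split_ifs <;> positivity

lemma v_x_le_y (j r m : ℕ) (hr : Even r) : vx j m ≤ ∑ T ∈ vT j (r + 1), vcy r T * vind T m := by
  rw [v_y_eq j r m hr, vx]
  split_ifs <;> simp

lemma v_y_sub_x (j r m : ℕ) (hr : Even r) : (∑ T ∈ vT j (r + 1), vcy r T * vind T m) - vx j m ≤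
    ∑ T ∈ vT j (r + 1), vct r T * vind T m := by
  rw [v_y_eq j r m hr, v_t_eq, vx]
  split_ifs with h
  · simp
  · rw [sub_zero]
    obtain ⟨n, hn⟩ : ∃ n, ((vP j).filter (· ∣ m)).card = n + 1 := ⟨_, (Nat.succ_pred_eq_of_ne_zero h).symm⟩
    rw [hn, Nat.choose_succ_succ]
    simp

noncomputable def vV (j : ℕ) : ℝ := ∏ p ∈ vP j, (1 - 1 / (p : ℝ))

lemma v_inv_le {j p : ℕ} (hp : p ∈ vP j) : 1 / (p : ℝ) ≤ 1 / 2 := by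
  apply one_div_le_one_div_of_le (by norm_num)
  exact_mod_cast (vP_prime hp).two_le

lemma vV_ge (j : ℕ) : Real.exp (-8) ≤ vV j := by
  unfold vV
  calc Real.exp (-8) ≤ Real.exp (∑ p ∈ vP j, (-2 * (1 / (p : ℝ)))) := by
        apply Real.exp_le_exp.2
        rw [← Finset.mul_sum]
        have := vP_sum_inv j
        linarith
    _ = ∏ p ∈ vP j, Real.exp (-2 * (1 / (p : ℝ))) := Real.exp_sum _ _
    _ ≤ _ := by
        apply Finset.prod_le_prod
        · intro _ _; positivity
        · intro p hp
          have h1 := v_inv_le hp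
          have h0 : 0 ≤ 1 / (p : ℝ) := by positivity
          generalize 1 / (p : ℝ) = x at *
          have h2 := Real.add_one_le_exp (2 * x)
          have h3 : Real.exp (-2 * x) * Real.exp (2 * x) = 1 := by rw [← Real.exp_add]; simp
          have h4 := Real.exp_pos (-2 * x)
          have h5 : 1 ≤ (1 - x) * (2 * x + 1) := by nlinarith
          have h6 : Real.exp (-2 * x) * (2 * x + 1) ≤ 1 := by nlinarith
          have h7 : 0 < 2 * x + 1 := by linarith
          nlinarith

lemma vV_pos (j : ℕ) : 0 < vV j := lt_of_lt_of_le (Real.exp_pos _) (vV_ge j)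

lemma v_prod_le_exp (j : ℕ) (a : ℝ) (ha : 0 ≤ a) :
    ∏ p ∈ vP j, (1 + a * (1 / (p : ℝ))) ≤ Real.exp (a * 4) := by
  calc ∏ p ∈ vP j, (1 + a * (1 / (p : ℝ))) ≤ ∏ p ∈ vP j, Real.exp (a * (1 / (p : ℝ))) := by
        apply Finset.prod_le_prod
        · intro _ _; positivity
        · intro p _
          have := Real.add_one_le_exp (a * (1 / (p : ℝ)))
          linarith
    _ = Real.exp (∑ p ∈ vP j, a * (1 / (p : ℝ))) := (Real.exp_sum _ _).symm
    _ ≤ _ := by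
        apply Real.exp_le_exp.2
        rw [← Finset.mul_sum]
        exact mul_le_mul_of_nonneg_left (vP_sum_inv j) ha

/-- tail of elementary symmetric sums -/
lemma v_tail (j r : ℕ) : ∑ T ∈ (vP j).powerset.filter (fun T => r + 1 ≤ T.card), ∏ p ∈ T, (1 / (p : ℝ)) ≤
    Real.exp 8 / 2 ^ (r + 1) := by
  rw [le_div_iff₀ (by positivity), Finset.sum_mul]
  have h := v_prod_le_exp j 2 (by norm_num)
  norm_num at h
  refine le_trans ?_ h
  have h2 : ∏ p ∈ vP j, (1 + 2 * ((p : ℝ)⁻¹)) = ∑ T ∈ (vP j).powerset, ∏ p ∈ T, (2 * ((p : ℝ)⁻¹)) := Finset.prod_one_add _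
  rw [h2]
  calc ∑ T ∈ (vP j).powerset.filter (fun T => r + 1 ≤ T.card), (∏ p ∈ T, (1 / (p : ℝ))) * 2 ^ (r + 1)
      ≤ ∑ T ∈ (vP j).powerset.filter (fun T => r + 1 ≤ T.card), ∏ p ∈ T, (2 * ((p : ℝ)⁻¹)) := by
        apply Finset.sum_le_sum
        intro T hT
        simp only [mem_filter] at hT
        rw [Finset.prod_mul_distrib, Finset.prod_const, mul_comm]
        simp only [one_div]
        apply mul_le_mul_of_nonneg_right
        · exact pow_le_pow_right₀ (by norm_num) hT.2
        · exact Finset.prod_nonneg (fun _ _ => by positivity)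
    _ ≤ _ := by
        apply Finset.sum_le_sum_of_subset_of_nonneg (Finset.filter_subset _ _)
        intro T _ _
        exact Finset.prod_nonneg (fun _ _ => by positivity)

lemma v_mean_t (j r : ℕ) : vmean j (r + 1) (vct r) ≤ Real.exp 8 / 2 ^ (r + 1) := by
  refine le_trans ?_ (v_tail j r)
  unfold vmean vct
  have : ∀ T ∈ vT j (r + 1), (if T.card = r + 1 then (1 : ℝ) else 0) * ∏ p ∈ T, (1 / (p : ℝ)) =
    if T.card = r + 1 then ∏ p ∈ T, (1 / (p : ℝ)) else 0 := by
    intro T _; split_ifs <;> simp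
  rw [Finset.sum_congr rfl this, ← Finset.sum_filter]
  apply Finset.sum_le_sum_of_subset_of_nonneg
  · intro T hT
    simp only [vT, mem_filter] at *
    exact ⟨hT.1.1, by omega⟩
  · intro T _ _
    exact Finset.prod_nonneg (fun _ _ => by positivity)

lemma v_mean_t_nonneg (j r : ℕ) : 0 ≤ vmean j (r + 1) (vct r) := by
  unfold vmean vct
  apply Finset.sum_nonneg
  intro T _
  apply mul_nonneg
  · split_ifs <;> norm_num
  · exact Finset.prod_nonneg (fun _ _ => by positivity)

lemma v_mean_y (j r : ℕ) : |vmean j (r + 1) (vcy r) - vV j| ≤ Real.exp 8 / 2 ^ (r + 1) := by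
  have h1 : vV j = ∑ T ∈ (vP j).powerset, (-1) ^ T.card * ∏ p ∈ T, (1 / (p : ℝ)) := by
    unfold vV
    have : ∏ p ∈ vP j, (1 - 1 / (p : ℝ)) = ∏ p ∈ vP j, (1 + (-1) * (1 / (p : ℝ))) := by
      apply Finset.prod_congr rfl; intros; ring
    rw [this, Finset.prod_one_add]
    apply Finset.sum_congr rfl
    intro T _
    rw [Finset.prod_mul_distrib, Finset.prod_const]
  have h2 : vmean j (r + 1) (vcy r) = ∑ T ∈ (vP j).powerset.filter (fun T => ¬ (r + 1 ≤ T.card)), (-1) ^ T.card * ∏ p ∈ T, (1 / (p : ℝ)) := by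
    unfold vmean vcy
    have : ∀ T ∈ vT j (r + 1), (if T.card ≤ r then (-1 : ℝ) ^ T.card else 0) * ∏ p ∈ T, (1 / (p : ℝ)) =
      if T.card ≤ r then (-1 : ℝ) ^ T.card * ∏ p ∈ T, (1 / (p : ℝ)) else 0 := by
      intro T _; split_ifs <;> simp
    rw [Finset.sum_congr rfl this, ← Finset.sum_filter]
    apply Finset.sum_congr _ (fun _ _ => rfl)
    ext T
    simp only [vT, mem_filter]
    constructor
    · rintro ⟨⟨a, b⟩, c⟩; exact ⟨a, by omega⟩
    · rintro ⟨a, b⟩; exact ⟨⟨a, by omega⟩, by omega⟩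
  rw [h1, h2, ← Finset.sum_filter_add_sum_filter_not (vP j).powerset (fun T => r + 1 ≤ T.card), sub_add_cancel_right, abs_neg]
  refine le_trans (Finset.abs_sum_le_sum_abs _ _) (le_trans (le_of_eq ?_) (v_tail j r))
  apply Finset.sum_congr rfl
  intro T _
  rw [abs_mul, abs_pow, abs_neg, abs_one, one_pow, one_mul, abs_of_nonneg]
  exact Finset.prod_nonneg (fun _ _ => by positivity)

noncomputable def vE : ℝ := Real.exp 16

lemma vE_pos : 0 < vE := Real.exp_pos _

lemma v_mean_y_le (j r : ℕ) : vmean j (r + 1) (vcy r) ≤ vV j * Real.exp (vE / 2 ^ (r + 1)) := by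
  have h1 := (abs_le.1 (v_mean_y j r)).2
  have h2 : Real.exp 8 / 2 ^ (r + 1) ≤ vV j * (vE / 2 ^ (r + 1)) := by
    have : Real.exp 8 = Real.exp (-8) * vE := by rw [vE, ← Real.exp_add]; norm_num
    rw [this, mul_div_assoc]
    apply mul_le_mul_of_nonneg_right (vV_ge j)
    have := vE_pos
    positivity
  have h3 := Real.add_one_le_exp (vE / 2 ^ (r + 1))
  have := mul_le_mul_of_nonneg_left h3 (vV_pos j).le
  linarith

lemma v_mean_y_nonneg (j r : ℕ) (h : vE / 2 ^ (r + 1) ≤ 1) : 0 ≤ vmean j (r + 1) (vcy r) := by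
  have h1 := (abs_le.1 (v_mean_y j r)).1
  have h2 : Real.exp 8 / 2 ^ (r + 1) ≤ vV j * (vE / 2 ^ (r + 1)) := by
    have : Real.exp 8 = Real.exp (-8) * vE := by rw [vE, ← Real.exp_add]; norm_num
    rw [this, mul_div_assoc]
    apply mul_le_mul_of_nonneg_right (vV_ge j)
    have := vE_pos
    positivity
  have := mul_le_mul_of_nonneg_left h (vV_pos j).le
  linarith

lemma v_mean_u (j r l : ℕ) (hl : l ∈ vP j) :
    vmean j (r + 1) (fun T => if l ∈ T then 1 else 0) ≤ Real.exp 4 / l := by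
  unfold vmean
  have h1 := v_prod_le_exp j 1 (by norm_num)
  simp only [one_mul] at h1
  have hl0 : (0 : ℝ) < l := by exact_mod_cast (vP_prime hl).pos
  rw [Finset.prod_one_add] at h1
  rw [le_div_iff₀ hl0]
  refine le_trans ?_ h1
  rw [Finset.sum_mul]
  have e1 : ∀ T ∈ vT j (r + 1), (if l ∈ T then (1 : ℝ) else 0) * (∏ p ∈ T, (1 / (p : ℝ))) * l =
     if l ∈ T then ∏ p ∈ T.erase l, (1 / (p : ℝ)) else 0 := by
    intro T _
    split_ifs with h
    · rw [← Finset.mul_prod_erase T _ h]; field_simp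
    · simp
  rw [Finset.sum_congr rfl e1, ← Finset.sum_filter]
  have e2 : ∑ T ∈ (vT j (r + 1)).filter (fun T => l ∈ T), ∏ p ∈ T.erase l, (1 / (p : ℝ)) =
     ∑ T ∈ (((vT j (r + 1)).filter (fun T => l ∈ T)).image (fun T : Finset ℕ => T.erase l) : Finset (Finset ℕ)), ∏ p ∈ T, (1 / ((p : ℕ) : ℝ)) := by
    rw [Finset.sum_image]
    intro T hT T' hT' h
    simp only [coe_filter, Set.mem_setOf_eq] at hT hT'
    simp only at h
    rw [← Finset.insert_erase hT.2, h, Finset.insert_erase hT'.2]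
  rw [e2]
  apply Finset.sum_le_sum_of_subset_of_nonneg
  · intro T hT
    simp only [mem_image, mem_filter] at hT
    obtain ⟨T', hT', rfl⟩ := hT
    rw [mem_powerset]
    exact (Finset.erase_subset _ _).trans (vT_sub hT'.1)
  · intro T _ _
    exact Finset.prod_nonneg (fun _ _ => by positivity)


def vr (J s : ℕ) (j : Fin J) : ℕ := 2 * (s + (J - 1 - j))
def vR (J s : ℕ) (j : Fin J) : ℕ := vr J s j + 1
noncomputable def vcc (J s : ℕ) (j : Fin J) : Finset ℕ → ℝ := vcy (vr J s j)
noncomputable def vw (J s m : ℕ) : ℝ := vF (vR J s) (vcc J s) m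
def vDD (J s : ℕ) : ℕ := vD (vR J s)
def vrough (J m : ℕ) : Prop := ∀ p : ℕ, p.Prime → p < 2 ^ (2 ^ J) → ¬ p ∣ m

lemma vr_even (J s : ℕ) (j : Fin J) : Even (vr J s j) := ⟨s + (J - 1 - j), by unfold vr; ring⟩

lemma vr_castSucc (J s : ℕ) (j : Fin J) : vr (J + 1) s j.castSucc = vr J (s + 1) j := by
  unfold vr
  have := j.2
  simp only [Fin.val_castSucc]
  omega

lemma vr_last (J s : ℕ) : vr (J + 1) s (Fin.last J) = 2 * s := by
  unfold vr; simp

lemma v_expo (J : ℕ) : ∀ s, ∑ j : Fin J, 2 ^ ((j : ℕ) + 1) * (vr J s j + 1) ≤ 2 ^ J * (4 * s + 6) := by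
  induction J with
  | zero => intro s; simp
  | succ J ih =>
    intro s
    rw [Fin.sum_univ_castSucc]
    simp only [vr_castSucc, vr_last, Fin.val_castSucc, Fin.val_last]
    have := ih (s + 1)
    rw [pow_succ]
    nlinarith

lemma vDD_le (J s : ℕ) : vDD J s ≤ 2 ^ (2 ^ J * (4 * s + 6)) := by
  unfold vDD vD vR
  have : ∏ j : Fin J, (2 ^ (2 ^ ((j : ℕ) + 1))) ^ (vr J s j + 1) = 2 ^ (∑ j : Fin J, 2 ^ ((j : ℕ) + 1) * (vr J s j + 1)) := by
    rw [← Finset.prod_pow_eq_pow_sum]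
    apply Finset.prod_congr rfl
    intro j _
    rw [← pow_mul]
  rw [this]
  exact Nat.pow_le_pow_right (by norm_num) (v_expo J s)

lemma vDD_pos (J s : ℕ) : 1 ≤ vDD J s := by
  unfold vDD vD
  exact Nat.one_le_iff_ne_zero.2 (Finset.prod_ne_zero_iff.2 (fun _ _ => by positivity))

lemma v_sigma (J : ℕ) : ∀ s, ∑ j : Fin J, (1 : ℝ) / 2 ^ (vr J s j + 1) ≤ 1 / 4 ^ s := by
  induction J with
  | zero => intro s; simp
  | succ J ih =>
    intro s
    rw [Fin.sum_univ_castSucc]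
    simp only [vr_castSucc, vr_last]
    have := ih (s + 1)
    have h1 : (1 : ℝ) / 4 ^ (s + 1) = 1 / 4 * (1 / 4 ^ s) := by rw [pow_succ]; field_simp
    have h2 : (1 : ℝ) / 2 ^ (2 * s + 1) = 1 / 2 * (1 / 4 ^ s) := by
      rw [pow_succ, pow_mul]; norm_num
    have h3 : (0 : ℝ) < 1 / 4 ^ s := by positivity
    rw [h2]
    linarith

lemma v_sigma_one (J s : ℕ) (hs : vE / 4 ^ s ≤ 1) (j : Fin J) : vE / 2 ^ (vr J s j + 1) ≤ 1 := by
  have h := v_sigma J s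
  have h1 : (1 : ℝ) / 2 ^ (vr J s j + 1) ≤ ∑ j : Fin J, (1 : ℝ) / 2 ^ (vr J s j + 1) :=
    Finset.single_le_sum (f := fun j : Fin J => (1 : ℝ) / 2 ^ (vr J s j + 1)) (fun _ _ => by positivity) (mem_univ j)
  have h2 : vE * (1 / 2 ^ (vr J s j + 1)) ≤ vE * (1 / 4 ^ s) := mul_le_mul_of_nonneg_left (h1.trans h) vE_pos.le
  rw [mul_one_div, mul_one_div] at h2
  linarith

lemma vcc_abs (J s : ℕ) : ∀ j, ∀ T, |vcc J s j T| ≤ 1 := by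
  intro j T
  unfold vcc vcy
  split_ifs <;> simp

lemma v_VV (J s : ℕ) (hs : vE / 4 ^ s ≤ 1) :
    ∏ j : Fin J, (vV j * Real.exp (vE / 2 ^ (vr J s j + 1))) ≤ 6 / 2 ^ J := by
  rw [Finset.prod_mul_distrib, ← Real.exp_sum]
  have h1 : ∏ j : Fin J, vV j ≤ 2 / 2 ^ J := v_euler J
  have h2 : ∑ j : Fin J, vE / 2 ^ (vr J s j + 1) ≤ 1 := by
    have h := mul_le_mul_of_nonneg_left (v_sigma J s) vE_pos.le
    rw [Finset.mul_sum] at h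
    simp only [mul_one_div] at h
    linarith
  have h3 : Real.exp (∑ j : Fin J, vE / 2 ^ (vr J s j + 1)) ≤ 3 := by
    calc _ ≤ Real.exp 1 := Real.exp_le_exp.2 h2
      _ ≤ 3 := by have := Real.exp_one_lt_d9; linarith
  calc _ ≤ (2 / 2 ^ J : ℝ) * 3 := by
        apply mul_le_mul h1 h3 (Real.exp_pos _).le (by positivity)
    _ = _ := by ring

lemma v_means (J s : ℕ) (hs : vE / 4 ^ s ≤ 1) :
    ∏ j : Fin J, vmean j (vR J s j) (vcc J s j) ≤ 6 / 2 ^ J := by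
  refine le_trans ?_ (v_VV J s hs)
  apply Finset.prod_le_prod
  · intro j _; exact v_mean_y_nonneg j _ (v_sigma_one J s hs j)
  · intro j _; exact v_mean_y_le j _

/-- W2 -/
lemma vw_mass (J s : ℕ) (hs : vE / 4 ^ s ≤ 1) (M : ℕ) :
    ∑ m ∈ Ioc 0 M, vw J s m ≤ 6 * M / 2 ^ J + vDD J s := by
  have h := v_mass (vR J s) (vcc J s) (vcc_abs J s) M
  have h2 := mul_le_mul_of_nonneg_left (v_means J s hs) (Nat.cast_nonneg (α := ℝ) M)
  have : (M : ℝ) * (6 / 2 ^ J) = 6 * M / 2 ^ J := by ring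
  unfold vw vDD
  linarith

lemma v_mass_upd (J s : ℕ) (hs : vE / 4 ^ s ≤ 1) (j0 : Fin J) (c : Finset ℕ → ℝ) (hc : ∀ T, |c T| ≤ 1)
    (a : ℝ) (ha : 0 ≤ a) (hm : vmean j0 (vR J s j0) c ≤ a) (M : ℕ) :
    ∑ m ∈ Ioc 0 M, vF (vR J s) (Function.update (vcc J s) j0 c) m ≤ (a * Real.exp 8) * (6 * M / 2 ^ J) + vDD J s := by
  have h := v_mass (vR J s) (Function.update (vcc J s) j0 c) (by
    intro j T
    by_cases hj : j = j0
    · subst hj; rw [Function.update_self]; exact hc T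
    · rw [Function.update_of_ne hj]; exact vcc_abs J s j T) M
  have h2 : ∏ j : Fin J, vmean j (vR J s j) (Function.update (vcc J s) j0 c j) ≤ (a * Real.exp 8) * (6 / 2 ^ J) := by
    rw [← Finset.mul_prod_erase univ _ (mem_univ j0)]
    rw [Function.update_self]
    have e1 : ∏ j ∈ univ.erase j0, vmean j (vR J s j) (Function.update (vcc J s) j0 c j) =
      ∏ j ∈ univ.erase j0, vmean j (vR J s j) (vcc J s j) := by
      apply Finset.prod_congr rfl
      intro j hj
      rw [Function.update_of_ne (Finset.ne_of_mem_erase hj)]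
    rw [e1]
    have n1 : 0 ≤ ∏ j ∈ univ.erase j0, vmean j (vR J s j) (vcc J s j) :=
      Finset.prod_nonneg (fun j _ => v_mean_y_nonneg j _ (v_sigma_one J s hs j))
    have e2 : ∏ j ∈ univ.erase j0, vmean j (vR J s j) (vcc J s j) ≤
      ∏ j ∈ univ.erase j0, (vV j * Real.exp (vE / 2 ^ (vr J s j + 1))) := by
      apply Finset.prod_le_prod
      · intro j _; exact v_mean_y_nonneg j _ (v_sigma_one J s hs j)
      · intro j _; exact v_mean_y_le j _
    have e3 : ∏ j ∈ univ.erase j0, (vV j * Real.exp (vE / 2 ^ (vr J s j + 1))) ≤ Real.exp 8 * (6 / 2 ^ J) := by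
      have e4 := v_VV J s hs
      rw [← Finset.mul_prod_erase univ _ (mem_univ j0)] at e4
      set Q := ∏ j ∈ univ.erase j0, (vV j * Real.exp (vE / 2 ^ (vr J s j + 1))) with hQ
      have q0 : 0 ≤ Q := Finset.prod_nonneg (fun j _ => mul_nonneg (vV_pos j).le (Real.exp_pos _).le)
      have q1 : Real.exp (-8) ≤ vV j0 * Real.exp (vE / 2 ^ (vr J s j0 + 1)) := by
        have := vV_ge j0
        have h1 : 1 ≤ Real.exp (vE / 2 ^ (vr J s j0 + 1)) := Real.one_le_exp (by have := vE_pos; positivity)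
        nlinarith [vV_pos j0]
      have q2 : Real.exp (-8) * Q ≤ 6 / 2 ^ J := (mul_le_mul_of_nonneg_right q1 q0).trans e4
      have q3 : Q = Real.exp 8 * (Real.exp (-8) * Q) := by
        rw [← mul_assoc, ← Real.exp_add]; simp
      rw [q3]
      exact mul_le_mul_of_nonneg_left q2 (Real.exp_pos _).le
    calc _ ≤ a * ∏ j ∈ univ.erase j0, vmean j (vR J s j) (vcc J s j) := mul_le_mul_of_nonneg_right hm n1
      _ ≤ a * (Real.exp 8 * (6 / 2 ^ J)) := mul_le_mul_of_nonneg_left (e2.trans e3) ha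
      _ = _ := by ring
  have h3 := mul_le_mul_of_nonneg_left h2 (Nat.cast_nonneg (α := ℝ) M)
  have : (M : ℝ) * (a * Real.exp 8 * (6 / 2 ^ J)) = (a * Real.exp 8) * (6 * M / 2 ^ J) := by ring
  unfold vDD
  linarith

lemma v_rough_eq (J m : ℕ) [Decidable (vrough J m)] : ∏ j : Fin J, vx j m = if vrough J m then 1 else 0 := by
  split_ifs with h
  · apply Finset.prod_eq_one
    intro j _
    unfold vx
    rw [if_pos]
    rw [Finset.card_eq_zero, Finset.filter_eq_empty_iff]
    intro p hp
    apply h p (vP_prime hp)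
    exact lt_of_lt_of_le (vP_lt hp) (Nat.pow_le_pow_right (by norm_num) (Nat.pow_le_pow_right (by norm_num) j.2))
  · unfold vrough at h
    push Not at h
    obtain ⟨p, hp, hlt, hd⟩ := h
    apply Finset.prod_eq_zero (mem_univ (⟨vcls p, vcls_lt hp hlt⟩ : Fin J))
    unfold vx
    rw [if_neg]
    rw [Finset.card_eq_zero]
    apply Finset.ne_empty_of_mem (a := p)
    rw [mem_filter]
    exact ⟨vP_mem hp, hd⟩

lemma vw_nonneg (J s m : ℕ) : 0 ≤ vw J s m :=
  by
  unfold vw vF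
  apply Finset.prod_nonneg
  intro j _; exact v_y_nonneg j _ m (vr_even J s j)

lemma vx_nonneg (j m : ℕ) : 0 ≤ vx j m := by unfold vx; split_ifs <;> norm_num

lemma vw_ge (J s m : ℕ) [Decidable (vrough J m)] : (if vrough J m then (1 : ℝ) else 0) ≤ vw J s m := by
  rw [← v_rough_eq]
  unfold vw vF
  apply Finset.prod_le_prod
  · intro j _; exact vx_nonneg _ _
  · intro j _; exact v_x_le_y j _ m (vr_even J s j)

lemma v_tele {ι : Type*} [DecidableEq ι] (S : Finset ι) (x y : ι → ℝ) (hx : ∀ i, 0 ≤ x i) (hxy : ∀ i, x i ≤ y i) :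
    ∏ i ∈ S, y i - ∏ i ∈ S, x i ≤ ∑ j ∈ S, (y j - x j) * ∏ i ∈ S.erase j, y i := by
  induction S using Finset.induction_on with
  | empty => simp
  | insert a S ha ih =>
    rw [Finset.prod_insert ha, Finset.prod_insert ha, Finset.sum_insert ha, Finset.erase_insert ha]
    have e : ∑ j ∈ S, (y j - x j) * ∏ i ∈ (insert a S).erase j, y i = y a * ∑ j ∈ S, (y j - x j) * ∏ i ∈ S.erase j, y i := by
      rw [Finset.mul_sum]
      apply Finset.sum_congr rfl
      intro j hj
      have : j ≠ a := fun h => ha (h ▸ hj)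
      rw [Finset.erase_insert_of_ne this.symm, Finset.prod_insert (fun h => ha (Finset.mem_of_mem_erase h))]
      ring
    rw [e]
    have h1 : ∏ i ∈ S, x i ≤ ∏ i ∈ S, y i := Finset.prod_le_prod (fun i _ => hx i) (fun i _ => hxy i)
    have h2 := mul_le_mul_of_nonneg_left ih ((hx a).trans (hxy a))
    have h3 := mul_nonneg (sub_nonneg.2 (hxy a)) (sub_nonneg.2 h1)
    nlinarith

lemma vF_upd {J : ℕ} (R : Fin J → ℕ) (c : Fin J → Finset ℕ → ℝ) (j0 : Fin J) (c0 : Finset ℕ → ℝ) (m : ℕ) :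
    vF R (Function.update c j0 c0) m = (∑ T ∈ vT j0 (R j0), c0 T * vind T m) *
      ∏ j ∈ univ.erase j0, ∑ T ∈ vT j (R j), c j T * vind T m := by
  unfold vF
  rw [← Finset.mul_prod_erase univ _ (mem_univ j0), Function.update_self]
  congr 1
  apply Finset.prod_congr rfl
  intro j hj
  rw [Function.update_of_ne (Finset.ne_of_mem_erase hj)]

/-- W3 -/
lemma vw_sub (J s : ℕ) (hs : vE / 4 ^ s ≤ 1) (M : ℕ) [DecidablePred (vrough J)] :
    ∑ m ∈ Ioc 0 M, (vw J s m - if vrough J m then 1 else 0) ≤ (vE / 4 ^ s) * (6 * M / 2 ^ J) + J * vDD J s := by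
  have h1 : ∀ m ∈ Ioc 0 M, (vw J s m - if vrough J m then 1 else 0) ≤
      ∑ j0 : Fin J, vF (vR J s) (Function.update (vcc J s) j0 (vct (vr J s j0))) m := by
    intro m _
    rw [← v_rough_eq]
    refine le_trans (v_tele univ (fun j : Fin J => vx j m) _ (fun j => vx_nonneg _ _) (fun j => v_x_le_y j _ m (vr_even J s j))) ?_
    apply Finset.sum_le_sum
    intro j _
    rw [vF_upd]
    apply mul_le_mul_of_nonneg_right (v_y_sub_x j _ m (vr_even J s j))
    exact Finset.prod_nonneg (fun i _ => v_y_nonneg i _ m (vr_even J s i))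
  refine le_trans (Finset.sum_le_sum h1) ?_
  rw [Finset.sum_comm]
  have h2 : ∀ j0 ∈ (univ : Finset (Fin J)), ∑ m ∈ Ioc 0 M, vF (vR J s) (Function.update (vcc J s) j0 (vct (vr J s j0))) m ≤
      (vE * (1 / 2 ^ (vr J s j0 + 1))) * (6 * M / 2 ^ J) + vDD J s := by
    intro j0 _
    have := v_mass_upd J s hs j0 (vct (vr J s j0)) (by intro T; unfold vct; split_ifs <;> simp)
      (Real.exp 8 / 2 ^ (vr J s j0 + 1)) (by positivity) (v_mean_t j0 _) M
    refine this.trans (le_of_eq ?_)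
    have e : vE = Real.exp 8 * Real.exp 8 := by rw [vE, ← Real.exp_add]; norm_num
    rw [e]; ring
  refine le_trans (Finset.sum_le_sum h2) ?_
  rw [Finset.sum_add_distrib, ← Finset.sum_mul, ← Finset.mul_sum]
  simp only [sum_const, card_univ, Fintype.card_fin, nsmul_eq_mul]
  have h3 := mul_le_mul_of_nonneg_left (v_sigma J s) vE_pos.le
  rw [mul_one_div] at h3
  have h4 : (0 : ℝ) ≤ 6 * M / 2 ^ J := by positivity
  have := mul_le_mul_of_nonneg_right h3 h4
  linarith


noncomputable def ve (x : ℝ) : ℂ := Complex.exp (2 * Real.pi * x * Complex.I)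
noncomputable def vnn (x : ℝ) : ℝ := |x - round x|

lemma ve_add (x y : ℝ) : ve (x + y) = ve x * ve y := by
  unfold ve; rw [← Complex.exp_add]; congr 1; push_cast; ring

lemma ve_norm (x : ℝ) : ‖ve x‖ = 1 := by
  unfold ve
  have : (2 * Real.pi * x * Complex.I : ℂ) = ((2 * Real.pi * x : ℝ) : ℂ) * Complex.I := by push_cast; ring
  rw [this, Complex.norm_exp_ofReal_mul_I]

lemma ve_int (n : ℤ) : ve n = 1 := by
  unfold ve
  have : (2 * Real.pi * ((n : ℝ) : ℂ) * Complex.I : ℂ) = n * (2 * Real.pi * Complex.I) := by push_cast; ring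
  rw [this, Complex.exp_int_mul_two_pi_mul_I]

lemma ve_zero : ve 0 = 1 := by unfold ve; simp

lemma ve_nat_mul (x : ℝ) (n : ℕ) : ve (x * n) = ve x ^ n := by
  unfold ve; rw [← Complex.exp_nat_mul]; congr 1; push_cast; ring

lemma ve_conj (x : ℝ) : (starRingEnd ℂ) (ve x) = ve (-x) := by
  unfold ve
  rw [← Complex.exp_conj]
  congr 1
  have : (2 * Real.pi * x * Complex.I : ℂ) = ((2 * Real.pi * x : ℝ) : ℂ) * Complex.I := by push_cast; ring
  rw [this, map_mul, Complex.conj_ofReal, Complex.conj_I]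
  push_cast; ring

lemma vnn_nonneg (x : ℝ) : 0 ≤ vnn x := abs_nonneg _

lemma vnn_le_half (x : ℝ) : vnn x ≤ 1 / 2 := abs_sub_round x

lemma vnn_le (x : ℝ) (n : ℤ) : vnn x ≤ |x - n| := round_le x n

lemma ve_sub_one (x : ℝ) : 4 * vnn x ≤ ‖ve x - 1‖ := by
  have h1 : ve x = ve (x - round x) := by
    conv_lhs => rw [show x = (x - round x) + (round x : ℤ) by ring]
    rw [ve_add, ve_int, mul_one]
  rw [h1]
  have h2 := vnn_le_half x
  unfold vnn at *
  generalize x - round x = y at *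
  have h3 : ve y = Complex.exp (Complex.I * ((2 * Real.pi * y : ℝ) : ℂ)) := by
    unfold ve; congr 1; push_cast; ring
  rw [h3, Complex.norm_exp_I_mul_ofReal_sub_one]
  have h4 : |2 * Real.pi * y / 2| ≤ Real.pi / 2 := by
    rw [show 2 * Real.pi * y / 2 = Real.pi * y by ring, abs_mul, abs_of_pos Real.pi_pos]
    nlinarith [Real.pi_pos]
  have h5 := Real.mul_abs_le_abs_sin h4
  rw [Real.norm_eq_abs, abs_mul, abs_two]
  have h6 : 2 / Real.pi * |2 * Real.pi * y / 2| = 2 * |y| := by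
    rw [show 2 * Real.pi * y / 2 = Real.pi * y by ring, abs_mul, abs_of_pos Real.pi_pos]
    field_simp
  linarith

lemma v_geom (γ κ : ℝ) (hκ : 0 < κ) (h : κ ≤ vnn γ) (M : ℕ) : ‖∑ m ∈ Ioc 0 M, ve (γ * (m : ℕ))‖ ≤ 1 / κ := by
  have h1 := ve_sub_one γ
  have h2 : 4 * κ ≤ ‖ve γ - 1‖ := by linarith
  have hne : ve γ ≠ 1 := by
    intro h0
    rw [h0] at h2; simp at h2; linarith
  have h3 : ∑ m ∈ Ioc 0 M, ve (γ * (m : ℕ)) = ve γ * ∑ i ∈ range M, ve γ ^ i := by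
    rw [Finset.mul_sum]
    have : ∀ m ∈ Ioc 0 M, ve (γ * (m : ℕ)) = ve γ ^ m := fun m _ => ve_nat_mul γ m
    rw [Finset.sum_congr rfl this, Finset.sum_bij (fun m _ => m - 1)]
    · intro a ha; simp only [mem_Ioc, mem_range] at *; omega
    · intro a ha b hb; simp only [mem_Ioc] at *; omega
    · intro b hb; exact ⟨b + 1, by simp only [mem_Ioc, mem_range] at *; omega, by omega⟩
    · intro a ha
      simp only [mem_Ioc] at ha
      rw [← pow_succ']; congr 1; omega
  rw [h3, geom_sum_eq hne, norm_mul, ve_norm, one_mul, norm_div]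
  have h4 : ‖ve γ ^ M - 1‖ ≤ 2 := by
    calc _ ≤ ‖ve γ ^ M‖ + ‖(1 : ℂ)‖ := norm_sub_le _ _
      _ = 2 := by rw [norm_pow, ve_norm]; norm_num
  rw [div_le_div_iff₀ (by linarith) hκ]
  nlinarith

lemma v_geom_dvd (γ κ : ℝ) (hκ : 0 < κ) (d : ℕ) (hd : 0 < d) (h : κ ≤ vnn (γ * d)) (M : ℕ) :
    ‖∑ m ∈ Ioc 0 M, (if d ∣ m then ve (γ * (m : ℕ)) else 0)‖ ≤ 1 / κ := by
  have : ∑ m ∈ Ioc 0 M, (if d ∣ m then ve (γ * (m : ℕ)) else 0) = ∑ k ∈ Ioc 0 (M / d), ve ((γ * d) * (k : ℕ)) := by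
    rw [← Finset.sum_filter]
    symm
    apply Finset.sum_bij (fun k _ => d * k)
    · intro k hk
      simp only [mem_Ioc, mem_filter] at *
      refine ⟨⟨Nat.mul_pos hd hk.1, ?_⟩, dvd_mul_right _ _⟩
      rw [mul_comm]; exact (Nat.le_div_iff_mul_le hd).1 hk.2
    · intro a _ b _ hab
      exact Nat.eq_of_mul_eq_mul_left hd hab
    · intro m hm
      simp only [mem_Ioc, mem_filter] at hm
      obtain ⟨⟨h1, h2⟩, k, rfl⟩ := hm
      refine ⟨k, ?_, rfl⟩
      simp only [mem_Ioc]
      exact ⟨Nat.pos_of_mul_pos_left h1, (Nat.le_div_iff_mul_le hd).2 (by rwa [mul_comm])⟩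
    · intro k _
      push_cast; congr 1; ring
  rw [this]
  exact v_geom _ κ hκ h _

lemma v_big_prime (q L : ℕ) (hq : Squarefree q) (h : L.factorial < q) : ∃ l, l.Prime ∧ l ∣ q ∧ L < l := by
  by_contra hc
  push Not at hc
  have h1 : q ∣ L.factorial := by
    rw [← Nat.prod_primeFactors_of_squarefree hq]
    apply Finset.prod_primes_dvd
    · intro p hp
      exact (Nat.prime_of_mem_primeFactors hp).prime
    · intro p hp
      rw [Nat.mem_primeFactors] at hp
      exact Nat.dvd_factorial hp.1.pos (hc p hp.1 hp.2.1)
  exact absurd (Nat.le_of_dvd (Nat.factorial_pos _) h1) (by omega)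

/-- there is a common denominator of the bad divisors -/
lemma v_common (γ : ℝ) (D : ℕ) (hD : 1 ≤ D) (d : ℕ) (hd : 0 < d) (hdD : d ≤ D) (hb : vnn (γ * d) < 1 / (2 * D)) :
    ∃ q : ℕ, 0 < q ∧ q ∣ d ∧ vnn (γ * q) < 1 / (2 * D) ∧
      ∀ d' : ℕ, 0 < d' → d' ≤ D → vnn (γ * d') < 1 / (2 * D) → q ∣ d' := by
  have hD0 : (0 : ℝ) < D := by exact_mod_cast hD
  set b := round (γ * d) with hbdef
  set g := Int.gcd b d with hg
  have hg0 : 0 < g := Int.gcd_pos_of_ne_zero_right _ (by exact_mod_cast hd.ne')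
  obtain ⟨q, hq⟩ : g ∣ d := by
    have := Int.gcd_dvd_right b (d : ℤ)
    exact_mod_cast this
  obtain ⟨a, ha⟩ := Int.gcd_dvd_left b (d : ℤ)
  rw [← hg] at ha
  have hq0 : 0 < q := by
    rcases Nat.eq_zero_or_pos q with h | h
    · rw [h] at hq; omega
    · exact h
  have hcop : IsCoprime (q : ℤ) a := by
    rw [Int.isCoprime_iff_gcd_eq_one, Int.gcd_comm]
    have h1 : Int.gcd (g * a) (g * q : ℤ) = g * Int.gcd a q := by rw [Int.gcd_mul_left]; simp
    rw [← ha, show ((g : ℤ) * q) = (d : ℤ) by rw [hq]; push_cast; rfl, ← hg] at h1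
    exact (Nat.eq_of_mul_eq_mul_left hg0 (by rw [mul_one]; exact h1)).symm
  refine ⟨q, hq0, ⟨g, by rw [hq, mul_comm]⟩, ?_, ?_⟩
  · refine lt_of_le_of_lt (vnn_le _ a) ?_
    have h1 : vnn (γ * d) = g * |γ * q - a| := by
      unfold vnn
      rw [← hbdef, ha]
      conv_lhs => rw [hq]
      push_cast
      rw [show γ * (g * q) - g * a = g * (γ * q - a) by ring, abs_mul, abs_of_nonneg (Nat.cast_nonneg (α := ℝ) g)]
    have h2 : (1 : ℝ) ≤ g := by exact_mod_cast hg0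
    rw [h1] at hb
    nlinarith [abs_nonneg (γ * q - a)]
  · intro d' hd' hdD' hb'
    set b' := round (γ * d') with hb'def
    have h1 : b * d' = b' * d := by
      have h2 : |((b * d' - b' * d : ℤ) : ℝ)| < 1 := by
        have e : ((b * d' - b' * d : ℤ) : ℝ) = (γ * d' - b') * d - (γ * d - b) * d' := by push_cast; ring
        rw [e]
        have t1 : |(γ * d' - b')| < 1 / (2 * D) := hb'
        have t2 : |(γ * d - b)| < 1 / (2 * D) := hb
        calc |(γ * d' - b') * d - (γ * d - b) * d'| ≤ |(γ * d' - b') * d| + |(γ * d - b) * d'| := abs_sub _ _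
          _ = |(γ * d' - b')| * d + |(γ * d - b)| * d' := by
              rw [abs_mul, abs_mul, abs_of_nonneg (Nat.cast_nonneg (α := ℝ) d), abs_of_nonneg (Nat.cast_nonneg (α := ℝ) d')]
          _ < 1 / (2 * D) * d + 1 / (2 * D) * d' := by
              have : (0 : ℝ) < d := by exact_mod_cast hd
              have : (0 : ℝ) < d' := by exact_mod_cast hd'
              gcongr
          _ ≤ 1 / (2 * D) * D + 1 / (2 * D) * D := by
              have : (d : ℝ) ≤ D := by exact_mod_cast hdD
              have : (d' : ℝ) ≤ D := by exact_mod_cast hdD'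
              gcongr
          _ = 1 := by field_simp; norm_num
      have h3 : |b * d' - b' * d| < 1 := by exact_mod_cast h2
      rw [Int.abs_lt_one_iff] at h3
      linarith
    rw [ha] at h1
    have h2 : (g : ℤ) * (a * d') = g * (b' * q) := by
      rw [show (d : ℤ) = g * q by rw [hq]; push_cast; rfl] at h1
      linarith
    have h3 : a * d' = b' * q := mul_left_cancel₀ (by exact_mod_cast hg0.ne') h2
    have h4 : (q : ℤ) ∣ a * d' := ⟨b', by rw [h3]; ring⟩
    have := hcop.dvd_of_dvd_mul_left h4
    exact_mod_cast this

lemma v_good_part {J : ℕ} (R : Fin J → ℕ) (c : Fin J → Finset ℕ → ℝ) (hc : ∀ j, ∀ T, |c j T| ≤ 1)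
    (γ κ : ℝ) (hκ : 0 < κ) (S : Finset (Fin J → Finset ℕ)) (hS : S ⊆ vOm R)
    (hg : ∀ τ ∈ S, κ ≤ vnn (γ * vd τ)) (M : ℕ) :
    ‖∑ m ∈ Ioc 0 M, ((∑ τ ∈ S, (∏ j, c j (τ j)) * (if vd τ ∣ m then 1 else 0) : ℝ) : ℂ) * ve (γ * (m : ℕ))‖ ≤ vD R * (1 / κ) := by
  have e : ∑ m ∈ Ioc 0 M, ((∑ τ ∈ S, (∏ j, c j (τ j)) * (if vd τ ∣ m then 1 else 0) : ℝ) : ℂ) * ve (γ * (m : ℕ)) =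
     ∑ τ ∈ S, ((∏ j, c j (τ j) : ℝ) : ℂ) * ∑ m ∈ Ioc 0 M, (if vd τ ∣ m then ve (γ * (m : ℕ)) else 0) := by
    simp_rw [Finset.mul_sum]
    rw [Finset.sum_comm]
    apply Finset.sum_congr rfl
    intro m _
    rw [Complex.ofReal_sum, Finset.sum_mul]
    apply Finset.sum_congr rfl
    intro τ _
    split_ifs <;> simp
  rw [e]
  calc _ ≤ ∑ τ ∈ S, ‖((∏ j, c j (τ j) : ℝ) : ℂ) * ∑ m ∈ Ioc 0 M, (if vd τ ∣ m then ve (γ * (m : ℕ)) else 0)‖ := norm_sum_le _ _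
    _ ≤ ∑ τ ∈ S, 1 / κ := by
        apply Finset.sum_le_sum
        intro τ hτ
        rw [norm_mul, Complex.norm_real, Real.norm_eq_abs]
        have h1 := v_absprod hc τ
        have h2 := v_geom_dvd γ κ hκ (vd τ) (vd_pos (hS hτ)) (hg τ hτ) M
        have := mul_le_mul h1 h2 (norm_nonneg _) (by norm_num)
        linarith
    _ = S.card * (1 / κ) := by rw [Finset.sum_const, nsmul_eq_mul]
    _ ≤ _ := by
        apply mul_le_mul_of_nonneg_right _ (by positivity)
        exact_mod_cast (Finset.card_le_card hS).trans (vOm_card_le R)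

/-- W4 -/
lemma vW4 (J s L : ℕ) (hs : vE / 4 ^ s ≤ 1) (hL : 1 ≤ L) (γ : ℝ)
    (hγ : ∀ r : ℕ, 1 ≤ r → r ≤ L.factorial → 1 / (2 * (vDD J s : ℝ)) ≤ vnn (γ * r)) (M : ℕ) :
    ‖∑ m ∈ Ioc 0 M, (vw J s m : ℂ) * ve (γ * (m : ℕ))‖ ≤ (vE / L) * (6 * M / 2 ^ J) + 3 * (vDD J s : ℝ) ^ 2 := by
  have hD1 : (1 : ℝ) ≤ vDD J s := by exact_mod_cast vDD_pos J s
  have hL0 : (0 : ℝ) < L := by exact_mod_cast hL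
  have hκ : 0 < 1 / (2 * (vDD J s : ℝ)) := by positivity
  have hgood : (vDD J s : ℝ) * (1 / (1 / (2 * (vDD J s : ℝ)))) = 2 * (vDD J s : ℝ) ^ 2 := by
    rw [one_div_one_div]; ring
  have hE := vE_pos
  by_cases hbad : ∃ τ ∈ vOm (vR J s), vnn (γ * vd τ) < 1 / (2 * (vDD J s : ℝ))
  · obtain ⟨τ0, hτ0, hb0⟩ := hbad
    obtain ⟨q, hq0, hqd, hqn, hqall⟩ := v_common γ (vDD J s) (vDD_pos J s) (vd τ0) (vd_pos hτ0) (vd_le hτ0) hb0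
    have hqL : L.factorial < q := by
      by_contra hc
      push Not at hc
      exact absurd (hγ q hq0 hc) (not_le.2 hqn)
    obtain ⟨l, hl, hlq, hLl⟩ := v_big_prime q L ((vd_squarefree hτ0).squarefree_of_dvd hqd) hqL
    obtain ⟨j0, hj0⟩ := (vd_prime_dvd hτ0 hl).1 (hlq.trans hqd)
    have hlP : l ∈ vP j0 := vT_sub (vOm_mem hτ0 j0) hj0
    have hsplit : ∀ m, vw J s m = (∑ τ ∈ (vOm (vR J s)).filter (fun τ => ¬ l ∈ τ j0), (∏ j, vcc J s j (τ j)) * (if vd τ ∣ m then 1 else 0)) +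
       vF (vR J s) (Function.update (vcc J s) j0 (fun T => if l ∈ T then vcc J s j0 T else 0)) m := by
      intro m
      rw [vw, vF_eq, vF_eq, ← Finset.sum_filter_not_add_sum_filter (vOm (vR J s)) (fun τ => l ∈ τ j0)]
      congr 1
      rw [Finset.sum_filter]
      apply Finset.sum_congr rfl
      intro τ _
      have e : ∏ j, Function.update (vcc J s) j0 (fun T => if l ∈ T then vcc J s j0 T else 0) j (τ j) =
         if l ∈ τ j0 then ∏ j, vcc J s j (τ j) else 0 := by
        rw [← Finset.mul_prod_erase univ _ (mem_univ j0), ← Finset.mul_prod_erase univ (fun j => vcc J s j (τ j)) (mem_univ j0), Function.update_self]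
        have : ∏ j ∈ univ.erase j0, Function.update (vcc J s) j0 (fun T => if l ∈ T then vcc J s j0 T else 0) j (τ j) =
          ∏ j ∈ univ.erase j0, vcc J s j (τ j) := by
          apply Finset.prod_congr rfl
          intro j hj
          rw [Function.update_of_ne (Finset.ne_of_mem_erase hj)]
        rw [this]
        split_ifs <;> simp
      rw [e]
      split_ifs <;> simp
    have hpt : ∀ m, |vF (vR J s) (Function.update (vcc J s) j0 (fun T => if l ∈ T then vcc J s j0 T else 0)) m| ≤
        vF (vR J s) (Function.update (vcc J s) j0 (fun T => if l ∈ T then 1 else 0)) m := by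
      intro m
      rw [vF_upd, vF_upd, abs_mul]
      have n : 0 ≤ ∏ j ∈ univ.erase j0, ∑ T ∈ vT j (vR J s j), vcc J s j T * vind T m := by
        apply Finset.prod_nonneg
        intro j _
        exact v_y_nonneg j _ m (vr_even J s j)
      rw [abs_of_nonneg n]
      apply mul_le_mul_of_nonneg_right _ n
      refine (Finset.abs_sum_le_sum_abs _ _).trans ?_
      apply Finset.sum_le_sum
      intro T _
      have i0 : 0 ≤ vind T m := by unfold vind; split_ifs <;> norm_num
      rw [abs_mul, abs_of_nonneg i0]
      apply mul_le_mul_of_nonneg_right _ i0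
      split_ifs
      · exact vcc_abs J s j0 T
      · simp
    have hA := v_good_part (vR J s) (vcc J s) (vcc_abs J s) γ _ hκ ((vOm (vR J s)).filter (fun τ => ¬ l ∈ τ j0)) (Finset.filter_subset _ _)
      (by
        intro τ hτ
        rw [mem_filter] at hτ
        by_contra hc
        push Not at hc
        have h1 := hlq.trans (hqall (vd τ) (vd_pos hτ.1) (vd_le hτ.1) hc)
        obtain ⟨j, hj⟩ := (vd_prime_dvd hτ.1 hl).1 h1
        have h2 := vP_cls (vT_sub (vOm_mem hτ.1 j) hj)
        have h3 := vP_cls hlP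
        have : j = j0 := Fin.ext (by omega)
        exact hτ.2 (this ▸ hj)) M
    have hB := v_mass_upd J s hs j0 (fun T => if l ∈ T then 1 else 0) (by intro T; split_ifs <;> simp) (Real.exp 4 / l)
      (by positivity) (v_mean_u j0 _ l hlP) M
    have hsum : ∑ m ∈ Ioc 0 M, (vw J s m : ℂ) * ve (γ * (m : ℕ)) =
      ∑ m ∈ Ioc 0 M, ((∑ τ ∈ (vOm (vR J s)).filter (fun τ => ¬ l ∈ τ j0), (∏ j, vcc J s j (τ j)) * (if vd τ ∣ m then 1 else 0) : ℝ) : ℂ) * ve (γ * (m : ℕ)) +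
      ∑ m ∈ Ioc 0 M, ((vF (vR J s) (Function.update (vcc J s) j0 (fun T => if l ∈ T then vcc J s j0 T else 0)) m : ℝ) : ℂ) * ve (γ * (m : ℕ)) := by
      rw [← Finset.sum_add_distrib]
      apply Finset.sum_congr rfl
      intro m _
      rw [hsplit m, Complex.ofReal_add, add_mul]
    have hC : ‖∑ m ∈ Ioc 0 M, ((vF (vR J s) (Function.update (vcc J s) j0 (fun T => if l ∈ T then vcc J s j0 T else 0)) m : ℝ) : ℂ) * ve (γ * (m : ℕ))‖ ≤
       ∑ m ∈ Ioc 0 M, vF (vR J s) (Function.update (vcc J s) j0 (fun T => if l ∈ T then 1 else 0)) m := by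
      refine (norm_sum_le _ _).trans (Finset.sum_le_sum ?_)
      intro m _
      rw [norm_mul, ve_norm, mul_one, Complex.norm_real, Real.norm_eq_abs]
      exact hpt m
    rw [hsum]
    refine (norm_add_le _ _).trans ?_
    have h12 : Real.exp 4 / l * Real.exp 8 ≤ vE / L := by
      have : Real.exp 4 / l * Real.exp 8 = Real.exp 12 / l := by
        rw [div_mul_eq_mul_div, ← Real.exp_add]; norm_num
      rw [this, vE]
      apply div_le_div₀ (Real.exp_pos _).le (Real.exp_le_exp.2 (by norm_num)) hL0
      exact_mod_cast hLl.le
    have h4 : (0 : ℝ) ≤ 6 * M / 2 ^ J := by positivity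
    have h5 := mul_le_mul_of_nonneg_right h12 h4
    have h6 : (vDD J s : ℝ) ≤ (vDD J s : ℝ) ^ 2 := by nlinarith
    have hA' : _ ≤ (vDD J s : ℝ) * (1 / (1 / (2 * (vDD J s : ℝ)))) := hA
    rw [hgood] at hA'
    linarith
  · push Not at hbad
    have hA := v_good_part (vR J s) (vcc J s) (vcc_abs J s) γ _ hκ (vOm (vR J s)) (Finset.Subset.refl _) hbad M
    simp_rw [vw, vF_eq]
    have hA' : _ ≤ (vDD J s : ℝ) * (1 / (1 / (2 * (vDD J s : ℝ)))) := hA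
    rw [hgood] at hA'
    refine hA'.trans ?_
    have : 0 ≤ (vE / L) * (6 * M / 2 ^ J) := by positivity
    nlinarith


def vJ (a N : ℕ) : ℕ := Nat.log 2 (Nat.log 2 N / a)

lemma vJ_spec (a N : ℕ) (ha : 0 < a) (h : a ≤ Nat.log 2 N) :
    2 ^ (vJ a N) * a ≤ Nat.log 2 N ∧ Nat.log 2 N ≤ 2 * a * 2 ^ (vJ a N) := by
  unfold vJ
  set n := Nat.log 2 N
  have h1 : 1 ≤ n / a := (Nat.one_le_div_iff ha).2 h
  constructor
  · calc 2 ^ (Nat.log 2 (n / a)) * a ≤ (n / a) * a := Nat.mul_le_mul_right _ (Nat.pow_log_le_self 2 (by omega))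
      _ ≤ n := Nat.div_mul_le_self _ _
  · have h2 : n / a < 2 ^ (Nat.log 2 (n / a) + 1) := Nat.lt_pow_succ_log_self (by norm_num) _
    have h3 := (Nat.div_lt_iff_lt_mul ha).1 h2
    rw [pow_succ] at h3
    nlinarith

lemma vJ_large (a C : ℕ) (ha : 0 < a) : ∃ N0, ∀ N ≥ N0, C ≤ vJ a N ∧ a ≤ Nat.log 2 N := by
  refine ⟨2 ^ (2 ^ C * a), fun N hN => ?_⟩
  have h1 : 2 ^ C * a ≤ Nat.log 2 N := Nat.le_log_of_pow_le (by norm_num) hN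
  constructor
  · unfold vJ
    apply Nat.le_log_of_pow_le (by norm_num)
    exact (Nat.le_div_iff_mul_le ha).2 h1
  · have : 1 ≤ 2 ^ C := Nat.one_le_two_pow
    nlinarith

lemma vDD_ge (J s : ℕ) (hJ : 1 ≤ J) : 2 ^ (2 ^ J) ≤ vDD J s := by
  unfold vDD vD
  have hj : J - 1 < J := by omega
  refine le_trans ?_ (Finset.single_le_prod' (f := fun j : Fin J => (2 ^ (2 ^ ((j : ℕ) + 1))) ^ (vR J s j)) (fun i _ => Nat.one_le_iff_ne_zero.2 (by positivity)) (mem_univ (⟨J - 1, hj⟩ : Fin J)))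
  simp only
  rw [Nat.sub_add_cancel hJ]
  exact Nat.le_self_pow (by unfold vR; omega) _

/-- all parameter relations -/
lemma v_par (s C : ℕ) : ∃ N0, ∀ N ≥ N0, ∃ J : ℕ, C ≤ J ∧ 1 ≤ J ∧ 2 ^ J * (10 * (4 * s + 6)) ≤ Nat.log 2 N ∧
    Nat.log 2 N ≤ 2 * (10 * (4 * s + 6)) * 2 ^ J ∧ (vDD J s) ^ 10 ≤ N ∧ 2 ^ (2 ^ J) ≤ vDD J s ∧
    2 ^ J ≤ vDD J s ∧ C ≤ vDD J s ∧ J ≤ vDD J s := by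
  obtain ⟨N0, h0⟩ := vJ_large (10 * (4 * s + 6)) (C + 1) (by positivity)
  refine ⟨N0 + 1, fun N hN => ⟨vJ (10 * (4 * s + 6)) N, ?_⟩⟩
  obtain ⟨h1, h2⟩ := h0 N (by omega)
  obtain ⟨h3, h4⟩ := vJ_spec _ N (by positivity) h2
  set J := vJ (10 * (4 * s + 6)) N
  have h5 := vDD_ge J s (by omega)
  have h6 : J < 2 ^ J := Nat.lt_two_pow_self
  have h7 : 2 ^ J < 2 ^ (2 ^ J) := Nat.lt_two_pow_self
  refine ⟨by omega, by omega, h3, h4, ?_, h5, by omega, by omega, by omega⟩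
  calc (vDD J s) ^ 10 ≤ (2 ^ (2 ^ J * (4 * s + 6))) ^ 10 := Nat.pow_le_pow_left (vDD_le J s) _
    _ = 2 ^ (2 ^ J * (10 * (4 * s + 6))) := by rw [← pow_mul]; congr 1; ring
    _ ≤ 2 ^ (Nat.log 2 N) := Nat.pow_le_pow_right (by norm_num) h3
    _ ≤ N := Nat.pow_log_le_self 2 (by omega)

lemma v_small (J D M : ℕ) (C : ℝ) (h1 : 2 ^ J ≤ D) (hC : C ≤ D) (hM : D ^ 4 ≤ M) :
    C * (D : ℝ) ^ 2 ≤ M / 2 ^ J := by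
  rw [le_div_iff₀ (by positivity)]
  have h1' : (2 : ℝ) ^ J ≤ D := by exact_mod_cast h1
  have h2' : (D : ℝ) ^ 4 ≤ M := by exact_mod_cast hM
  calc C * (D : ℝ) ^ 2 * 2 ^ J ≤ D * (D : ℝ) ^ 2 * D := by gcongr
    _ = (D : ℝ) ^ 4 := by ring
    _ ≤ M := h2'

lemma v_irr (β : ℝ) (hβ : Irrational β) (H : ℕ) : ∃ c : ℝ, 0 < c ∧ ∀ h : ℤ, h ≠ 0 → |h| ≤ H → c ≤ vnn (β * h) := by
  have hpos : ∀ h : ℤ, h ≠ 0 → 0 < vnn (β * h) := by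
    intro h hh
    unfold vnn
    rw [abs_pos, sub_ne_zero]
    exact (hβ.mul_intCast hh).ne_int _
  by_cases hne : ((Icc (-(H : ℤ)) H).filter (fun h => h ≠ 0)).Nonempty
  · obtain ⟨h0, hh0, hmin⟩ := Finset.exists_min_image _ (fun h : ℤ => vnn (β * h)) hne
    rw [mem_filter] at hh0
    refine ⟨vnn (β * h0), hpos h0 hh0.2, fun h hh hH => hmin h ?_⟩
    rw [mem_filter, mem_Icc]
    exact ⟨abs_le.1 hH, hh⟩
  · refine ⟨1, one_pos, fun h hh hH => absurd ⟨h, ?_⟩ hne⟩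
    rw [mem_filter, mem_Icc]
    exact ⟨abs_le.1 hH, hh⟩

lemma v_quad (P S : Finset ℕ) (w : ℕ → ℝ) (f : ℕ → ℕ → ℂ) :
    ∑ m ∈ S, w m * ‖∑ p ∈ P, f p m‖ ^ 2 ≤
      ∑ p ∈ P, ∑ q ∈ P, ‖∑ m ∈ S, (w m : ℂ) * (f p m * (starRingEnd ℂ) (f q m))‖ := by
  have h1 : ((∑ m ∈ S, w m * ‖∑ p ∈ P, f p m‖ ^ 2 : ℝ) : ℂ) =
      ∑ p ∈ P, ∑ q ∈ P, ∑ m ∈ S, (w m : ℂ) * (f p m * (starRingEnd ℂ) (f q m)) := by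
    have e : ∀ m ∈ S, ((w m * ‖∑ p ∈ P, f p m‖ ^ 2 : ℝ) : ℂ) = ∑ p ∈ P, ∑ q ∈ P, (w m : ℂ) * (f p m * (starRingEnd ℂ) (f q m)) := by
      intro m _
      push_cast
      rw [← Complex.mul_conj', map_sum, Finset.sum_mul_sum, Finset.mul_sum]
      simp_rw [Finset.mul_sum]
    rw [Complex.ofReal_sum, Finset.sum_congr rfl e, Finset.sum_comm]
    apply Finset.sum_congr rfl
    intro p _
    rw [Finset.sum_comm]
  calc ∑ m ∈ S, w m * ‖∑ p ∈ P, f p m‖ ^ 2 ≤ ‖((∑ m ∈ S, w m * ‖∑ p ∈ P, f p m‖ ^ 2 : ℝ) : ℂ)‖ := by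
        rw [Complex.norm_real]; exact le_abs_self _
    _ ≤ _ := by
        rw [h1]
        refine (norm_sum_le _ _).trans (Finset.sum_le_sum (fun p _ => norm_sum_le _ _))

lemma ve_sub_one_le (y : ℝ) : ‖ve y - 1‖ ≤ 2 * Real.pi * |y| := by
  have h3 : ve y = Complex.exp (Complex.I * ((2 * Real.pi * y : ℝ) : ℂ)) := by
    unfold ve; congr 1; push_cast; ring
  rw [h3]
  have := Real.norm_exp_I_mul_ofReal_sub_one_le (x := 2 * Real.pi * y)
  refine this.trans (le_of_eq ?_)
  rw [Real.norm_eq_abs, abs_mul, abs_of_pos (by positivity)]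

lemma v_fejer (x : ℝ) (K : ℕ) (hK : 1 ≤ K) (h : vnn x ≤ 1 / (16 * K)) : (K : ℝ) / 2 ≤ ‖∑ k ∈ range K, ve (x * (k : ℕ))‖ := by
  have hK0 : (0 : ℝ) < K := by exact_mod_cast hK
  have h1 : ∀ k ∈ range K, ‖ve (x * (k : ℕ)) - 1‖ ≤ 1 / 2 := by
    intro k hk
    rw [mem_range] at hk
    have e : ve (x * (k : ℕ)) = ve ((x - round x) * k) := by
      have : x * (k : ℕ) = (x - round x) * k + ((round x * k : ℤ) : ℝ) := by push_cast; ring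
      rw [this, ve_add, ve_int, mul_one]
    rw [e]
    refine (ve_sub_one_le _).trans ?_
    rw [abs_mul]
    have hv : |x - round x| ≤ 1 / (16 * K) := h
    have hk' : |(k : ℝ)| ≤ K := by rw [abs_of_nonneg (Nat.cast_nonneg _)]; exact_mod_cast hk.le
    have hpi := Real.pi_lt_four
    calc 2 * Real.pi * (|x - round x| * |(k : ℝ)|) ≤ 2 * 4 * (1 / (16 * K) * K) := by gcongr
      _ = 1 / 2 := by field_simp; norm_num
  have h2 : ‖∑ k ∈ range K, (ve (x * (k : ℕ)) - 1)‖ ≤ K * (1 / 2) := by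
    refine (norm_sum_le _ _).trans ((Finset.sum_le_sum h1).trans ?_)
    simp
  have h3 : ∑ k ∈ range K, (ve (x * (k : ℕ)) - 1) = ∑ k ∈ range K, ve (x * (k : ℕ)) - K := by
    rw [Finset.sum_sub_distrib]; simp
  rw [h3] at h2
  have h4 : (K : ℝ) = ‖(K : ℂ)‖ := by simp
  have h5 := norm_sub_norm_le (K : ℂ) (∑ k ∈ range K, ve (x * (k : ℕ)))
  rw [← h4, norm_sub_rev] at h5
  linarith


lemma v_rough_prime (J p : ℕ) (hp : p.Prime) (h : 2 ^ (2 ^ J) ≤ p) : vrough J p := by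
  intro q hq hlt hd
  have := (Nat.prime_dvd_prime_iff_eq hq hp).1 hd
  omega

lemma vw_ge_one (J s m : ℕ) (h : vrough J m) : 1 ≤ vw J s m := by
  classical
  have := vw_ge J s m
  rwa [if_pos h] at this

set_option maxHeartbeats 1000000 in
lemma v_BT (β : ℝ) (hβ : Irrational β) (ε : ℝ) (hε : 0 < ε) : ∃ κ : ℝ, 0 < κ ∧ ∃ X0 : ℕ, ∀ X ≥ X0, ∀ θ : ℝ,
    (((Ioc 0 X).filter (fun p : ℕ => p.Prime ∧ vnn (β * p - θ) ≤ κ)).card : ℝ) ≤ ε * X / Nat.log 2 X := by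
  obtain ⟨s, hs⟩ : ∃ s : ℕ, vE / 4 ^ s ≤ 1 := by
    obtain ⟨s, hs⟩ := pow_unbounded_of_one_lt vE (show (1 : ℝ) < 4 by norm_num)
    exact ⟨s, by rw [div_le_one (by positivity)]; exact hs.le⟩
  have hE := vE_pos
  set A : ℝ := 2 * (10 * (4 * s + 6)) with hA
  have hA0 : 0 < A := by positivity
  obtain ⟨K, hK⟩ := exists_nat_gt (max 1 ((4 * (7 + 6 * vE) + 1) * A / ε))
  have hK1 : (1 : ℝ) < K := lt_of_le_of_lt (le_max_left _ _) hK
  have hK1n : 1 ≤ K := by exact_mod_cast hK1.le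
  have hK2 : (4 * (7 + 6 * vE) + 1) * A ≤ ε * K := by
    have := lt_of_le_of_lt (le_max_right _ _) hK
    rw [div_lt_iff₀ hε] at this
    linarith
  have hK0 : (0 : ℝ) < K := by linarith
  obtain ⟨c, hc0, hc⟩ := v_irr β hβ (K * K.factorial)
  obtain ⟨C, hC⟩ := exists_nat_gt (max (4 * (K : ℝ) ^ 2) (1 / (2 * c)))
  have hC1 : 4 * (K : ℝ) ^ 2 ≤ C := ((le_max_left _ _).trans_lt hC).le
  have hC2 : 1 / (2 * c) ≤ C := ((le_max_right _ _).trans_lt hC).le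
  obtain ⟨X0, hX0⟩ := v_par s C
  refine ⟨1 / (16 * K), by positivity, X0 + 4, fun X hX θ => ?_⟩
  obtain ⟨J, -, hJ1, -, hlog, hD10, hzD, hJD, hCD, -⟩ := hX0 X (by omega)
  set D := vDD J s with hDdef
  have hD1n : 1 ≤ D := vDD_pos J s
  have hD1 : (1 : ℝ) ≤ D := by exact_mod_cast hD1n
  have hCD' : (C : ℝ) ≤ D := by exact_mod_cast hCD
  set U : ℝ := X / 2 ^ J with hU
  have hU0 : 0 ≤ U := by positivity
  have hsm : (4 * (K : ℝ) ^ 2) * (D : ℝ) ^ 2 ≤ U :=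
    v_small J D X _ hJD (hC1.trans hCD') ((Nat.pow_le_pow_right hD1n (by norm_num)).trans hD10)
  have hmass : ∑ m ∈ Ioc 0 X, vw J s m ≤ 6 * U + D := by
    have := vw_mass J s hs X
    have e : 6 * (X : ℝ) / 2 ^ J = 6 * U := by rw [hU]; ring
    rw [e] at this; exact this
  -- large sieve type sum
  have hq := v_quad (range K) (Ioc 0 X) (vw J s) (fun k m => ve ((β * m - θ) * (k : ℕ)))
  have hterm : ∀ k ∈ range K, ∀ l ∈ range K,
      ‖∑ m ∈ Ioc 0 X, (vw J s m : ℂ) * (ve ((β * (m : ℕ) - θ) * (k : ℕ)) * (starRingEnd ℂ) (ve ((β * (m : ℕ) - θ) * (l : ℕ))))‖ ≤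
        (if k = l then (6 * U + D) else 0) + ((vE / K) * (6 * U) + 3 * (D : ℝ) ^ 2) := by
    intro k hk l hl
    rw [mem_range] at hk hl
    by_cases hkl : k = l
    · rw [if_pos hkl]
      have h1 : ‖∑ m ∈ Ioc 0 X, (vw J s m : ℂ) * (ve ((β * (m : ℕ) - θ) * (k : ℕ)) * (starRingEnd ℂ) (ve ((β * (m : ℕ) - θ) * (l : ℕ))))‖ ≤
         ∑ m ∈ Ioc 0 X, vw J s m := by
        refine (norm_sum_le _ _).trans (Finset.sum_le_sum ?_)
        intro m _
        rw [norm_mul, norm_mul, ve_norm, RCLike.norm_conj, ve_norm, Complex.norm_real, Real.norm_eq_abs, abs_of_nonneg (vw_nonneg J s m)]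
        simp
      have : 0 ≤ (vE / K) * (6 * U) + 3 * (D : ℝ) ^ 2 := by positivity
      linarith
    · rw [if_neg hkl, zero_add]
      have e : ∑ m ∈ Ioc 0 X, (vw J s m : ℂ) * (ve ((β * (m : ℕ) - θ) * (k : ℕ)) * (starRingEnd ℂ) (ve ((β * (m : ℕ) - θ) * (l : ℕ)))) =
          ve (-θ * (k - l)) * ∑ m ∈ Ioc 0 X, (vw J s m : ℂ) * ve ((β * ((k : ℤ) - (l : ℤ) : ℤ)) * (m : ℕ)) := by
        rw [Finset.mul_sum]
        apply Finset.sum_congr rfl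
        intro m _
        rw [ve_conj, ← ve_add, mul_left_comm, ← ve_add]
        congr 2
        push_cast; ring
      rw [e, norm_mul, ve_norm, one_mul]
      have h4 := vW4 J s K hs hK1n (β * ((k : ℤ) - (l : ℤ) : ℤ)) (by
        intro r hr1 hr2
        have hne : ((k : ℤ) - l) * r ≠ 0 := mul_ne_zero (by omega) (by omega)
        have hle : |((k : ℤ) - l) * r| ≤ ((K * K.factorial : ℕ) : ℤ) := by
          rw [abs_mul]
          push_cast
          apply mul_le_mul
          · rw [abs_le]; constructor <;> omega
          · rw [abs_of_nonneg (by positivity)]; exact_mod_cast hr2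
          · positivity
          · positivity
        have h5 := hc _ hne hle
        have h6 : 1 / (2 * (D : ℝ)) ≤ c := by
          rw [div_le_iff₀ (by positivity)]
          rw [div_le_iff₀ (by positivity)] at hC2
          nlinarith
        refine h6.trans (h5.trans (le_of_eq ?_))
        congr 1
        push_cast; ring) X
      have e2 : 6 * (X : ℝ) / 2 ^ J = 6 * U := by rw [hU]; ring
      rw [e2] at h4
      exact h4
  have hT : ∑ m ∈ Ioc 0 X, vw J s m * ‖∑ k ∈ range K, ve ((β * (m : ℕ) - θ) * (k : ℕ))‖ ^ 2 ≤ K * (7 + 6 * vE) * U := by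
    refine hq.trans ?_
    refine (Finset.sum_le_sum (fun k hk => Finset.sum_le_sum (fun l hl => hterm k hk l hl))).trans ?_
    simp_rw [Finset.sum_add_distrib, Finset.sum_ite_eq]
    rw [Finset.sum_congr rfl (fun k hk => if_pos hk)]
    simp only [sum_const, card_range, nsmul_eq_mul]
    have e : (K : ℝ) * (K * ((vE / K) * (6 * U))) = K * (6 * vE * U) := by field_simp
    have e1 : (D : ℝ) ≤ (D : ℝ) ^ 2 := by nlinarith
    have e2 : K * (D : ℝ) ≤ K ^ 2 * D ^ 2 := by
      have : (K : ℝ) ≤ K ^ 2 := by nlinarith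
      gcongr
    have e3 : U ≤ K * U := by nlinarith
    rw [e]
    linarith
  set S1 := (Ioc 0 X).filter (fun p : ℕ => (p.Prime ∧ vnn (β * p - θ) ≤ 1 / (16 * K)) ∧ 2 ^ (2 ^ J) ≤ p) with hS1
  have hlow : (S1.card : ℝ) * ((K : ℝ) / 2) ^ 2 ≤ K * (7 + 6 * vE) * U := by
    refine le_trans ?_ hT
    calc (S1.card : ℝ) * ((K : ℝ) / 2) ^ 2 = ∑ m ∈ S1, ((K : ℝ) / 2) ^ 2 := by rw [Finset.sum_const, nsmul_eq_mul]
      _ ≤ ∑ m ∈ S1, vw J s m * ‖∑ k ∈ range K, ve ((β * (m : ℕ) - θ) * (k : ℕ))‖ ^ 2 := by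
          apply Finset.sum_le_sum
          intro m hm
          rw [hS1, mem_filter] at hm
          have h1 := vw_ge_one J s m (v_rough_prime J m hm.2.1.1 hm.2.2)
          have h2 := v_fejer _ K hK1n hm.2.1.2
          have h3 : ((K : ℝ) / 2) ^ 2 ≤ ‖∑ k ∈ range K, ve ((β * (m : ℕ) - θ) * (k : ℕ))‖ ^ 2 := by gcongr
          nlinarith [sq_nonneg ‖∑ k ∈ range K, ve ((β * (m : ℕ) - θ) * (k : ℕ))‖]
      _ ≤ _ := by
          apply Finset.sum_le_sum_of_subset_of_nonneg (Finset.filter_subset _ _)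
          intro m _ _
          have := vw_nonneg J s m
          positivity
  have hcard : (((Ioc 0 X).filter (fun p : ℕ => p.Prime ∧ vnn (β * p - θ) ≤ 1 / (16 * K))).card : ℝ) ≤ S1.card + D := by
    have : ((Ioc 0 X).filter (fun p : ℕ => p.Prime ∧ vnn (β * p - θ) ≤ 1 / (16 * K))).card ≤ S1.card + (range (2 ^ (2 ^ J))).card := by
      refine le_trans (Finset.card_le_card ?_) (Finset.card_union_le _ _)
      intro p hp
      rw [mem_union, hS1, mem_filter, mem_range]
      rw [mem_filter] at hp
      by_cases h : 2 ^ (2 ^ J) ≤ p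
      · exact Or.inl ⟨hp.1, hp.2, h⟩
      · exact Or.inr (by omega)
    rw [card_range] at this
    exact_mod_cast this.trans (Nat.add_le_add_left hzD _)
  refine hcard.trans ?_
  have h1 : (S1.card : ℝ) * K ≤ 4 * (7 + 6 * vE) * U := by
    have : (K : ℝ) * (S1.card * K) ≤ K * (4 * (7 + 6 * vE) * U) := by linarith
    exact le_of_mul_le_mul_left this hK0
  have h2 : (D : ℝ) * K ≤ U := by
    have e1 : (D : ℝ) ≤ (D : ℝ) ^ 2 := by nlinarith
    have e2 : (K : ℝ) ≤ 4 * K ^ 2 := by nlinarith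
    calc (D : ℝ) * K ≤ D ^ 2 * (4 * K ^ 2) := by gcongr
      _ = (4 * (K : ℝ) ^ 2) * (D : ℝ) ^ 2 := by ring
      _ ≤ U := hsm
  have hlog0 : (0 : ℝ) < Nat.log 2 X := by
    have : 0 < Nat.log 2 X := Nat.log_pos (by norm_num) (by omega)
    exact_mod_cast this
  have h3 : U * Nat.log 2 X ≤ A * X := by
    have : (Nat.log 2 X : ℝ) ≤ A * 2 ^ J := by rw [hA]; exact_mod_cast hlog
    calc U * Nat.log 2 X ≤ U * (A * 2 ^ J) := by gcongr
      _ = A * X := by rw [hU]; field_simp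
  rw [le_div_iff₀ hlog0]
  have h4 : ((S1.card : ℝ) + D) * K ≤ (4 * (7 + 6 * vE) + 1) * U := by linarith
  have h5 : (((S1.card : ℝ) + D) * Nat.log 2 X) * K ≤ (ε * X) * K := by
    calc (((S1.card : ℝ) + D) * Nat.log 2 X) * K = (((S1.card : ℝ) + D) * K) * Nat.log 2 X := by ring
      _ ≤ ((4 * (7 + 6 * vE) + 1) * U) * Nat.log 2 X := by gcongr
      _ = (4 * (7 + 6 * vE) + 1) * (U * Nat.log 2 X) := by ring
      _ ≤ (4 * (7 + 6 * vE) + 1) * (A * X) := by gcongr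
      _ = ((4 * (7 + 6 * vE) + 1) * A) * X := by ring
      _ ≤ (ε * K) * X := by gcongr
      _ = (ε * X) * K := by ring
  exact le_of_mul_le_mul_right h5 hK0


def vQ (k : ℕ) : Finset ℕ := (Ico (2 ^ k) (2 ^ (k + 1))).filter Nat.Prime

lemma vQ_card (k : ℕ) (hk : 1 ≤ k) : ((vQ k).card : ℝ) ≤ 4 * (2 ^ k / k) := by
  have h := v_dyadic k
  have hk0 : (0 : ℝ) < k := by exact_mod_cast hk
  rw [← mul_div_assoc, le_div_iff₀ hk0]
  exact_mod_cast h

lemma v_pair (J s L : ℕ) (hs : vE / 4 ^ s ≤ 1) (hL : 1 ≤ L) (α : ℝ) (N k : ℕ)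
    (h3 : 3 * L * (vDD J s : ℝ) ^ 2 ≤ ((N / 2 ^ k : ℕ) : ℝ) / 2 ^ J)
    (p q : ℕ) (hp : 2 ^ k ≤ p) [Decidable (∃ r : ℕ, 1 ≤ r ∧ r ≤ L.factorial ∧ vnn (α * r * p - α * r * q) < 1 / (2 * (vDD J s : ℝ)))] :
    ‖∑ m ∈ Ioc 0 (N / 2 ^ k), (vw J s m : ℂ) * ((if m ≤ N / p then ve (α * (p : ℕ) * (m : ℕ)) else 0) *
      (starRingEnd ℂ) (if m ≤ N / q then ve (α * (q : ℕ) * (m : ℕ)) else 0))‖ ≤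
     (6 * vE + 1) * (((N / 2 ^ k : ℕ) : ℝ) / 2 ^ J) / L + (if ∃ r : ℕ, 1 ≤ r ∧ r ≤ L.factorial ∧ vnn (α * r * p - α * r * q) < 1 / (2 * (vDD J s : ℝ)) then 7 * (((N / 2 ^ k : ℕ) : ℝ) / 2 ^ J) else 0) := by
  set M := N / 2 ^ k with hM
  set U : ℝ := (M : ℝ) / 2 ^ J with hU
  have hU0 : 0 ≤ U := by positivity
  have hE := vE_pos
  have hL1 : (1 : ℝ) ≤ L := by exact_mod_cast hL
  have hD1 : (1 : ℝ) ≤ vDD J s := by exact_mod_cast vDD_pos J s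
  set M' := min (N / p) (N / q) with hM'
  have hMM : M' ≤ M := (min_le_left _ _).trans (Nat.div_le_div_left hp (by positivity))
  have e : ∑ m ∈ Ioc 0 M, (vw J s m : ℂ) * ((if m ≤ N / p then ve (α * (p : ℕ) * (m : ℕ)) else 0) *
      (starRingEnd ℂ) (if m ≤ N / q then ve (α * (q : ℕ) * (m : ℕ)) else 0)) =
      ∑ m ∈ Ioc 0 M', (vw J s m : ℂ) * ve ((α * (p : ℕ) - α * (q : ℕ)) * (m : ℕ)) := by
    symm
    have h0 : Ioc 0 M' = (Ioc 0 M).filter (fun m => m ≤ M') := by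
      ext m; simp only [mem_Ioc, mem_filter]; omega
    rw [h0, Finset.sum_filter]
    apply Finset.sum_congr rfl
    intro m _
    by_cases h1 : m ≤ N / p
    · by_cases h2 : m ≤ N / q
      · rw [if_pos h1, if_pos h2, if_pos (le_min h1 h2), ve_conj, ← ve_add]
        congr 2; ring
      · rw [if_neg h2, if_neg (fun h => h2 (h.trans (min_le_right _ _)))]; simp
    · rw [if_neg h1, if_neg (fun h => h1 (h.trans (min_le_left _ _)))]; simp
  rw [e]
  have hM'U : 6 * (M' : ℝ) / 2 ^ J ≤ 6 * U := by
    have : (M' : ℝ) ≤ M := by exact_mod_cast hMM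
    rw [hU, ← mul_div_assoc]; gcongr
  split_ifs with hbad
  · have h1 : ‖∑ m ∈ Ioc 0 M', (vw J s m : ℂ) * ve ((α * (p : ℕ) - α * (q : ℕ)) * (m : ℕ))‖ ≤ ∑ m ∈ Ioc 0 M', vw J s m := by
      refine (norm_sum_le _ _).trans (Finset.sum_le_sum ?_)
      intro m _
      rw [norm_mul, ve_norm, Complex.norm_real, Real.norm_eq_abs, abs_of_nonneg (vw_nonneg J s m), mul_one]
    have h2 := vw_mass J s hs M'
    have h4 : (vDD J s : ℝ) ≤ U := by
      refine le_trans ?_ h3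
      have e1 : (vDD J s : ℝ) ≤ (vDD J s : ℝ) ^ 2 := by nlinarith
      nlinarith
    have : 0 ≤ (6 * vE + 1) * U / L := by positivity
    linarith
  · push Not at hbad
    have h1 := vW4 J s L hs hL (α * (p : ℕ) - α * (q : ℕ)) (by
      intro r h1 h2
      refine (hbad r h1 h2).trans (le_of_eq ?_)
      congr 1; ring) M'
    have h2 : (vE / L) * (6 * (M' : ℝ) / 2 ^ J) ≤ (vE / L) * (6 * U) := mul_le_mul_of_nonneg_left hM'U (by positivity)
    have h4 : 3 * (vDD J s : ℝ) ^ 2 ≤ U / L := by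
      rw [le_div_iff₀ (by linarith)]; linarith
    have h5 : (6 * vE + 1) * U / L = (vE / L) * (6 * U) + U / L := by ring
    linarith

lemma v_block (J s L : ℕ) (hs : vE / 4 ^ s ≤ 1) (hL : 1 ≤ L) (α δ : ℝ) (N k : ℕ) (hk : 1 ≤ k) (b : ℕ → ℝ)
    (hb : ∀ m, |b m| ≤ vw J s m)
    (h3 : 3 * L * (vDD J s : ℝ) ^ 2 ≤ ((N / 2 ^ k : ℕ) : ℝ) / 2 ^ J)
    (hbad : ∀ (q : ℕ) (S : Finset ℕ), (∀ p ∈ S, p ∈ vQ k ∧ ∃ r : ℕ, 1 ≤ r ∧ r ≤ L.factorial ∧ vnn (α * r * p - α * r * q) < 1 / (2 * (vDD J s : ℝ))) →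
       (S.card : ℝ) ≤ δ * (2 ^ k / k)) :
    ‖∑ p ∈ vQ k, ∑ m ∈ Ioc 0 (N / p), (b m : ℂ) * ve (α * (p : ℕ) * (m : ℕ))‖ ^ 2 ≤
      7 * (16 * (6 * vE + 1) / L + 28 * δ) * ((2 ^ k / k) * (((N / 2 ^ k : ℕ) : ℝ) / 2 ^ J)) ^ 2 := by
  classical
  have hpair := fun p q hp => v_pair J s L hs hL α N k h3 p q hp
  set M := N / 2 ^ k with hM
  set U : ℝ := (M : ℝ) / 2 ^ J with hU
  set G : ℝ := 2 ^ k / k with hG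
  have hU0 : 0 ≤ U := by positivity
  have hG0 : 0 ≤ G := by positivity
  have hE := vE_pos
  have hL1 : (1 : ℝ) ≤ L := by exact_mod_cast hL
  have hD1 : (1 : ℝ) ≤ vDD J s := by exact_mod_cast vDD_pos J s
  have hcard := vQ_card k hk
  have hge : ∀ p ∈ vQ k, 2 ^ k ≤ p := by
    intro p hp; simp only [vQ, mem_filter, mem_Ico] at hp; exact hp.1.1
  have e : ∑ p ∈ vQ k, ∑ m ∈ Ioc 0 (N / p), (b m : ℂ) * ve (α * (p : ℕ) * (m : ℕ)) =
      ∑ m ∈ Ioc 0 M, (b m : ℂ) * ∑ p ∈ vQ k, (if m ≤ N / p then ve (α * (p : ℕ) * (m : ℕ)) else 0) := by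
    simp_rw [Finset.mul_sum]
    rw [Finset.sum_comm (s := Ioc 0 M)]
    apply Finset.sum_congr rfl
    intro p hp
    have hle : N / p ≤ M := Nat.div_le_div_left (hge p hp) (by positivity)
    have h0 : Ioc 0 (N / p) = (Ioc 0 M).filter (fun m => m ≤ N / p) := by
      ext m; simp only [mem_Ioc, mem_filter]; omega
    rw [h0, Finset.sum_filter]
    apply Finset.sum_congr rfl
    intro m _
    split_ifs <;> simp
  rw [e]
  set F : ℕ → ℂ := fun m => ∑ p ∈ vQ k, (if m ≤ N / p then ve (α * (p : ℕ) * (m : ℕ)) else 0) with hF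
  have h1 : ‖∑ m ∈ Ioc 0 M, (b m : ℂ) * F m‖ ≤ ∑ m ∈ Ioc 0 M, vw J s m * ‖F m‖ := by
    refine (norm_sum_le _ _).trans (Finset.sum_le_sum ?_)
    intro m _
    rw [norm_mul, Complex.norm_real, Real.norm_eq_abs]
    exact mul_le_mul_of_nonneg_right (hb m) (norm_nonneg _)
  have h2 : (∑ m ∈ Ioc 0 M, vw J s m * ‖F m‖) ^ 2 ≤ (∑ m ∈ Ioc 0 M, vw J s m) * ∑ m ∈ Ioc 0 M, vw J s m * ‖F m‖ ^ 2 := by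
    apply Finset.sum_sq_le_sum_mul_sum_of_sq_eq_mul
    · intro m _; exact vw_nonneg J s m
    · intro m _; exact mul_nonneg (vw_nonneg J s m) (sq_nonneg _)
    · intro m _; ring
  have hmass : ∑ m ∈ Ioc 0 M, vw J s m ≤ 7 * U := by
    have := vw_mass J s hs M
    have e : 6 * (M : ℝ) / 2 ^ J = 6 * U := by rw [hU]; ring
    have h4 : (vDD J s : ℝ) ≤ U := by
      refine le_trans ?_ h3
      have e1 : (vDD J s : ℝ) ≤ (vDD J s : ℝ) ^ 2 := by nlinarith
      nlinarith
    linarith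
  have hq : ∑ m ∈ Ioc 0 M, vw J s m * ‖F m‖ ^ 2 ≤ (16 * (6 * vE + 1) / L + 28 * δ) * (G ^ 2 * U) := by
    refine (v_quad (vQ k) (Ioc 0 M) (vw J s) (fun p m => (if m ≤ N / p then ve (α * (p : ℕ) * (m : ℕ)) else 0))).trans ?_
    refine (Finset.sum_le_sum (fun p hp => Finset.sum_le_sum (fun q _ => hpair p q (hge p hp)))).trans ?_
    rw [Finset.sum_comm]
    have hin : ∀ q ∈ vQ k, ∑ p ∈ vQ k, ((6 * vE + 1) * U / L + (if ∃ r : ℕ, 1 ≤ r ∧ r ≤ L.factorial ∧ vnn (α * r * p - α * r * q) < 1 / (2 * (vDD J s : ℝ)) then 7 * U else 0)) ≤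
        4 * G * ((6 * vE + 1) * U / L) + δ * G * (7 * U) := by
      intro q _
      rw [Finset.sum_add_distrib, ← Finset.sum_filter, Finset.sum_const, Finset.sum_const, nsmul_eq_mul, nsmul_eq_mul]
      apply add_le_add
      · exact mul_le_mul_of_nonneg_right hcard (by positivity)
      · apply mul_le_mul_of_nonneg_right _ (by positivity)
        apply hbad q
        intro p hp
        rw [mem_filter] at hp
        exact hp
    refine (Finset.sum_le_sum hin).trans ?_
    rw [Finset.sum_const, nsmul_eq_mul]
    have hδ0 : 0 ≤ δ * G := by
      have := hbad 0 ∅ (by simp)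
      simpa using this
    calc ((vQ k).card : ℝ) * (4 * G * ((6 * vE + 1) * U / L) + δ * G * (7 * U)) ≤
          (4 * G) * (4 * G * ((6 * vE + 1) * U / L) + δ * G * (7 * U)) := by
          apply mul_le_mul_of_nonneg_right hcard
          have : 0 ≤ δ * G * (7 * U) := mul_nonneg hδ0 (by positivity)
          positivity
      _ = _ := by ring
  have hq0 : 0 ≤ ∑ m ∈ Ioc 0 M, vw J s m * ‖F m‖ ^ 2 := Finset.sum_nonneg (fun m _ => mul_nonneg (vw_nonneg J s m) (sq_nonneg _))
  calc ‖∑ m ∈ Ioc 0 M, (b m : ℂ) * F m‖ ^ 2 ≤ (∑ m ∈ Ioc 0 M, vw J s m * ‖F m‖) ^ 2 := by gcongr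
    _ ≤ _ := h2
    _ ≤ (7 * U) * ((16 * (6 * vE + 1) / L + 28 * δ) * (G ^ 2 * U)) := by
        apply mul_le_mul hmass hq hq0 (by positivity)
    _ = _ := by ring


lemma v_dvd_sum (f : ℕ → ℂ) (d : ℕ) (hd : 0 < d) (N : ℕ) :
    ∑ n ∈ Ioc 0 N, (if d ∣ n then f n else 0) = ∑ k ∈ Ioc 0 (N / d), f (d * k) := by
  rw [← Finset.sum_filter]
  symm
  apply Finset.sum_bij (fun k _ => d * k)
  · intro k hk
    simp only [mem_Ioc, mem_filter] at *
    refine ⟨⟨Nat.mul_pos hd hk.1, ?_⟩, dvd_mul_right _ _⟩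
    rw [mul_comm]; exact (Nat.le_div_iff_mul_le hd).1 hk.2
  · intro a _ b _ hab
    exact Nat.eq_of_mul_eq_mul_left hd hab
  · intro m hm
    simp only [mem_Ioc, mem_filter] at hm
    obtain ⟨⟨h1, h2⟩, k, rfl⟩ := hm
    refine ⟨k, ?_, rfl⟩
    simp only [mem_Ioc]
    exact ⟨Nat.pos_of_mul_pos_left h1, (Nat.le_div_iff_mul_le hd).2 (by rwa [mul_comm])⟩
  · intro k _
    rfl

def vQQ (J K0 : ℕ) : Finset ℕ := (Ico (2 ^ (2 ^ J)) (2 ^ K0)).filter Nat.Prime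
def vom (J K0 m : ℕ) : ℕ := ((vQQ J K0).filter (· ∣ m)).card
open Classical in
noncomputable def vb (J K0 m : ℕ) : ℝ := if vrough J m then 1 / (1 + (vom J K0 m : ℝ)) else 0

lemma vQQ_sum (J K0 : ℕ) (f : ℕ → ℂ) : ∑ p ∈ vQQ J K0, f p = ∑ k ∈ Ico (2 ^ J) K0, ∑ p ∈ vQ k, f p := by
  rw [← Finset.sum_biUnion]
  · apply Finset.sum_congr _ (fun _ _ => rfl)
    ext p
    simp only [vQQ, vQ, mem_filter, mem_Ico, mem_biUnion]
    constructor
    · rintro ⟨⟨h1, h2⟩, hp⟩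
      have hp0 : p ≠ 0 := hp.ne_zero
      refine ⟨Nat.log 2 p, ⟨Nat.le_log_of_pow_le (by norm_num) h1, Nat.log_lt_of_lt_pow hp0 h2⟩, ⟨Nat.pow_log_le_self 2 hp0, Nat.lt_pow_succ_log_self (by norm_num) _⟩, hp⟩
    · rintro ⟨k, ⟨h1, h2⟩, ⟨h3, h4⟩, hp⟩
      refine ⟨⟨(Nat.pow_le_pow_right (by norm_num) h1).trans h3, h4.trans_le (Nat.pow_le_pow_right (by norm_num) h2)⟩, hp⟩
  · intro a _ b _ hab
    rw [Function.onFun, Finset.disjoint_left]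
    intro p hp hp'
    simp only [vQ, mem_filter, mem_Ico] at hp hp'
    apply hab
    rw [← (Nat.log_eq_iff (b := 2) (m := a) (n := p) (Or.inr ⟨by norm_num, hp.2.ne_zero⟩)).2 hp.1]
    exact (Nat.log_eq_iff (Or.inr ⟨by norm_num, hp.2.ne_zero⟩)).2 hp'.1

lemma vb_le (J K0 s m : ℕ) : |vb J K0 m| ≤ vw J s m := by
  unfold vb
  split_ifs with h
  · have h1 := vw_ge_one J s m h
    rw [abs_of_nonneg (by positivity)]
    refine le_trans ?_ h1
    rw [div_le_one (by positivity)]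
    have : (0 : ℝ) ≤ vom J K0 m := by positivity
    linarith
  · simp [vw_nonneg]

lemma v_rough_mul (J p m : ℕ) (hp : p.Prime) (hz : 2 ^ (2 ^ J) ≤ p) : vrough J (p * m) ↔ vrough J m := by
  constructor
  · intro h q hq hlt hd
    exact h q hq hlt (hd.mul_left p)
  · intro h q hq hlt hd
    rcases hq.dvd_mul.1 hd with h1 | h1
    · exact v_rough_prime J p hp hz q hq hlt h1
    · exact h q hq hlt h1

lemma vom_mul (J K0 p m : ℕ) (hp : p ∈ vQQ J K0) (hpm : ¬ p ∣ m) : vom J K0 (p * m) = 1 + vom J K0 m := by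
  unfold vom
  have hpp : p.Prime := by simp only [vQQ, mem_filter] at hp; exact hp.2
  have : (vQQ J K0).filter (· ∣ p * m) = insert p ((vQQ J K0).filter (· ∣ m)) := by
    ext q
    simp only [mem_filter, mem_insert]
    constructor
    · rintro ⟨h1, h2⟩
      have hq : q.Prime := by simp only [vQQ, mem_filter] at h1; exact h1.2
      rcases hq.dvd_mul.1 h2 with h3 | h3
      · left; exact (Nat.prime_dvd_prime_iff_eq hq hpp).1 h3
      · right; exact ⟨h1, h3⟩
    · rintro (rfl | ⟨h1, h2⟩)
      · exact ⟨hp, dvd_mul_right _ _⟩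
      · exact ⟨h1, h2.mul_left p⟩
  rw [this, Finset.card_insert_of_notMem (by simp [hpm]), add_comm]

open Classical in
lemma v_coef (J K0 p m : ℕ) (hp : p ∈ vQQ J K0) :
    |(if vrough J (p * m) then 1 / (vom J K0 (p * m) : ℝ) else 0) - vb J K0 m| ≤ if p ∣ m then 1 else 0 := by
  have hp' := hp
  simp only [vQQ, mem_filter, mem_Ico] at hp'
  unfold vb
  rw [if_congr (v_rough_mul J p m hp'.2 hp'.1.1) rfl rfl]
  by_cases hr : vrough J m
  · rw [if_pos hr, if_pos hr]
    by_cases hd : p ∣ m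
    · rw [if_pos hd]
      have h1 : 1 ≤ vom J K0 (p * m) := by
        unfold vom
        rw [Nat.one_le_iff_ne_zero, Finset.card_ne_zero]
        exact ⟨p, by rw [mem_filter]; exact ⟨hp, dvd_mul_right _ _⟩⟩
      have h1' : (1 : ℝ) ≤ vom J K0 (p * m) := by exact_mod_cast h1
      have a1 : 1 / (vom J K0 (p * m) : ℝ) ≤ 1 := by rw [div_le_one (by linarith)]; exact h1'
      have a2 : 0 ≤ 1 / (vom J K0 (p * m) : ℝ) := by positivity
      have b1 : 1 / (1 + (vom J K0 m : ℝ)) ≤ 1 := by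
        rw [div_le_one (by positivity)]
        have : (0 : ℝ) ≤ vom J K0 m := by positivity
        linarith
      have b2 : 0 ≤ 1 / (1 + (vom J K0 m : ℝ)) := by positivity
      rw [abs_le]; constructor <;> linarith
    · rw [if_neg hd, vom_mul J K0 p m hp hd]
      simp
  · rw [if_neg hr, if_neg hr]
    split_ifs <;> simp

open Classical in
lemma v_rough_zero (J K0 N n : ℕ) (hJ : 2 ^ J ≤ K0) (hY : N < (2 ^ K0) ^ 2) (hn : n ≤ N) (hn1 : 2 ^ K0 ≤ n) :
    (vrough J n ∧ vom J K0 n = 0) ↔ n.Prime := by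
  have hzY : 2 ^ (2 ^ J) ≤ 2 ^ K0 := Nat.pow_le_pow_right (by norm_num) hJ
  constructor
  · rintro ⟨h1, h2⟩
    have hn2 : n ≠ 1 := by
      have : 2 ^ 1 ≤ 2 ^ K0 := Nat.pow_le_pow_right (by norm_num) (Nat.one_le_two_pow.trans hJ)
      omega
    have hn0 : 0 < n := lt_of_lt_of_le (by positivity) hn1
    by_contra hnp
    have hm := Nat.minFac_prime hn2
    have hsq := Nat.minFac_sq_le_self hn0 hnp
    have hz : 2 ^ (2 ^ J) ≤ n.minFac := by
      by_contra hc
      exact h1 _ hm (by omega) (Nat.minFac_dvd n)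
    have hlt : n.minFac < 2 ^ K0 := by
      by_contra hc
      push Not at hc
      have := Nat.pow_le_pow_left hc 2
      omega
    unfold vom at h2
    rw [Finset.card_eq_zero, Finset.filter_eq_empty_iff] at h2
    exact h2 (x := n.minFac) (by simp only [vQQ, mem_filter, mem_Ico]; exact ⟨⟨hz, hlt⟩, hm⟩) (Nat.minFac_dvd n)
  · intro hp
    refine ⟨v_rough_prime J n hp (hzY.trans hn1), ?_⟩
    unfold vom
    rw [Finset.card_eq_zero, Finset.filter_eq_empty_iff]
    intro q hq hd
    simp only [vQQ, mem_filter, mem_Ico] at hq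
    have := (Nat.prime_dvd_prime_iff_eq hq.2 hp).1 hd
    omega

open Classical in
lemma v_buchstab (J K0 N : ℕ) (α : ℝ) (hJ : 2 ^ J ≤ K0) (hY : N < (2 ^ K0) ^ 2) :
    ‖∑ n ∈ (Ioc 0 N).filter Nat.Prime, ve (α * (n : ℕ))‖ ≤
      ‖∑ n ∈ Ioc 0 N, (if vrough J n then ve (α * (n : ℕ)) else 0)‖ +
      ∑ k ∈ Ico (2 ^ J) K0, ‖∑ p ∈ vQ k, ∑ m ∈ Ioc 0 (N / p), (vb J K0 m : ℂ) * ve (α * (p : ℕ) * (m : ℕ))‖ +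
      2 ^ K0 + 2 * N / 2 ^ (2 ^ J) := by
  set S0 := ∑ n ∈ Ioc 0 N, (if vrough J n ∧ vom J K0 n = 0 then ve (α * (n : ℕ)) else 0) with hS0
  set SR := ∑ n ∈ Ioc 0 N, (if vrough J n then ve (α * (n : ℕ)) else 0) with hSR
  set S1 := ∑ n ∈ Ioc 0 N, (if vrough J n ∧ vom J K0 n ≠ 0 then ve (α * (n : ℕ)) else 0) with hS1
  set B := ∑ p ∈ vQQ J K0, ∑ m ∈ Ioc 0 (N / p), (vb J K0 m : ℂ) * ve (α * (p : ℕ) * (m : ℕ)) with hB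
  have h1 : ‖∑ n ∈ (Ioc 0 N).filter Nat.Prime, ve (α * (n : ℕ)) - S0‖ ≤ 2 ^ K0 := by
    rw [Finset.sum_filter, hS0, ← Finset.sum_sub_distrib]
    refine (norm_sum_le _ _).trans ?_
    have : ∀ n ∈ Ioc 0 N, ‖(if n.Prime then ve (α * (n : ℕ)) else 0) - (if vrough J n ∧ vom J K0 n = 0 then ve (α * (n : ℕ)) else 0)‖ ≤
        if n < 2 ^ K0 then 1 else 0 := by
      intro n hn
      rw [mem_Ioc] at hn
      by_cases hc : n < 2 ^ K0
      · rw [if_pos hc]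
        split_ifs <;> simp [ve_norm]
      · rw [if_neg hc, if_congr (v_rough_zero J K0 N n hJ hY hn.2 (by omega)) rfl rfl]
        simp
    refine (Finset.sum_le_sum this).trans ?_
    rw [← Finset.sum_filter, Finset.sum_const, nsmul_eq_mul, mul_one]
    have hc : ((Ioc 0 N).filter (fun n => n < 2 ^ K0)).card ≤ (range (2 ^ K0)).card := by
      apply Finset.card_le_card
      intro n hn
      rw [mem_filter] at hn
      rw [mem_range]; exact hn.2
    rw [card_range] at hc
    exact_mod_cast hc
  have h2 : SR = S0 + S1 := by
    rw [hSR, hS0, hS1, ← Finset.sum_add_distrib]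
    apply Finset.sum_congr rfl
    intro n _
    by_cases hr : vrough J n <;> by_cases ho : vom J K0 n = 0 <;> simp [hr, ho]
  have h3 : S1 = ∑ p ∈ vQQ J K0, ∑ m ∈ Ioc 0 (N / p), (((if vrough J (p * m) then 1 / (vom J K0 (p * m) : ℝ) else 0 : ℝ)) : ℂ) * ve (α * (p : ℕ) * (m : ℕ)) := by
    have e1 : ∀ p ∈ vQQ J K0, ∑ m ∈ Ioc 0 (N / p), (((if vrough J (p * m) then 1 / (vom J K0 (p * m) : ℝ) else 0 : ℝ)) : ℂ) * ve (α * (p : ℕ) * (m : ℕ)) =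
      ∑ n ∈ Ioc 0 N, (if p ∣ n then (((if vrough J n then 1 / (vom J K0 n : ℝ) else 0 : ℝ)) : ℂ) * ve (α * (n : ℕ)) else 0) := by
      intro p hp
      have hpp : p.Prime := by simp only [vQQ, mem_filter] at hp; exact hp.2
      rw [v_dvd_sum (fun n => (((if vrough J n then 1 / (vom J K0 n : ℝ) else 0 : ℝ)) : ℂ) * ve (α * (n : ℕ))) p hpp.pos]
      apply Finset.sum_congr rfl
      intro m _
      congr 2
      push_cast; ring
    rw [Finset.sum_congr rfl e1, Finset.sum_comm, hS1]
    apply Finset.sum_congr rfl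
    intro n _
    rw [← Finset.sum_filter, Finset.sum_const, nsmul_eq_mul]
    change _ = (vom J K0 n : ℂ) * _
    by_cases hr : vrough J n <;> by_cases ho : vom J K0 n = 0
    · simp [ho]
    · have : (vom J K0 n : ℂ) ≠ 0 := by exact_mod_cast ho
      simp [hr, ho]
    · simp [hr]
    · simp [hr]
  have h4 : ‖S1 - B‖ ≤ 2 * N / 2 ^ (2 ^ J) := by
    rw [h3, hB, ← Finset.sum_sub_distrib]
    have e1 : ∀ p ∈ vQQ J K0, ‖∑ m ∈ Ioc 0 (N / p), (((if vrough J (p * m) then 1 / (vom J K0 (p * m) : ℝ) else 0 : ℝ)) : ℂ) * ve (α * (p : ℕ) * (m : ℕ)) -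
        ∑ m ∈ Ioc 0 (N / p), (vb J K0 m : ℂ) * ve (α * (p : ℕ) * (m : ℕ))‖ ≤ N * (((p : ℝ) ^ 2)⁻¹) := by
      intro p hp
      have hpp : p.Prime := by simp only [vQQ, mem_filter] at hp; exact hp.2
      rw [← Finset.sum_sub_distrib]
      refine (norm_sum_le _ _).trans ?_
      have e2 : ∀ m ∈ Ioc 0 (N / p), ‖(((if vrough J (p * m) then 1 / (vom J K0 (p * m) : ℝ) else 0 : ℝ)) : ℂ) * ve (α * (p : ℕ) * (m : ℕ)) -
         (vb J K0 m : ℂ) * ve (α * (p : ℕ) * (m : ℕ))‖ ≤ if p ∣ m then 1 else 0 := by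
        intro m _
        rw [← sub_mul, norm_mul, ve_norm, mul_one, ← Complex.ofReal_sub, Complex.norm_real, Real.norm_eq_abs]
        exact v_coef J K0 p m hp
      refine (Finset.sum_le_sum e2).trans ?_
      rw [← Finset.sum_filter, Finset.sum_const, nsmul_eq_mul, mul_one, Nat.Ioc_filter_dvd_card_eq_div, Nat.div_div_eq_div_mul]
      refine Nat.cast_div_le.trans (le_of_eq ?_)
      push_cast; rw [div_eq_mul_inv, pow_two]
    refine (norm_sum_le _ _).trans ((Finset.sum_le_sum e1).trans ?_)
    rw [← Finset.mul_sum]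
    have e3 : ∑ p ∈ vQQ J K0, (((p : ℝ) ^ 2)⁻¹) ≤ 2 / 2 ^ (2 ^ J) := by
      have hz : 1 ≤ 2 ^ (2 ^ J) := Nat.one_le_two_pow
      have h := sum_Ioo_inv_sq_le (α := ℝ) (2 ^ (2 ^ J) - 1) (2 ^ K0)
      have e4 : (((2 ^ (2 ^ J) - 1 : ℕ) : ℝ) + 1) = 2 ^ (2 ^ J) := by
        rw [Nat.cast_sub hz]; push_cast; ring
      rw [e4] at h
      refine le_trans ?_ h
      apply Finset.sum_le_sum_of_subset_of_nonneg
      · intro p hp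
        simp only [vQQ, mem_filter, mem_Ico] at hp
        rw [mem_Ioo]; omega
      · intro _ _ _; positivity
    calc (N : ℝ) * ∑ p ∈ vQQ J K0, (((p : ℝ) ^ 2)⁻¹) ≤ N * (2 / 2 ^ (2 ^ J)) := mul_le_mul_of_nonneg_left e3 (by positivity)
      _ = _ := by ring
  have h5 : ‖B‖ ≤ ∑ k ∈ Ico (2 ^ J) K0, ‖∑ p ∈ vQ k, ∑ m ∈ Ioc 0 (N / p), (vb J K0 m : ℂ) * ve (α * (p : ℕ) * (m : ℕ))‖ := by
    rw [hB, vQQ_sum]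
    exact norm_sum_le _ _
  have h6 : ∑ n ∈ (Ioc 0 N).filter Nat.Prime, ve (α * (n : ℕ)) =
     (∑ n ∈ (Ioc 0 N).filter Nat.Prime, ve (α * (n : ℕ)) - S0) + (SR - (S1 - B) - B) := by
    rw [h2]; ring
  rw [h6]
  refine (norm_add_le _ _).trans ?_
  have h7 := norm_sub_le (SR - (S1 - B)) B
  have h8 := norm_sub_le SR (S1 - B)
  linarith


lemma v_BTR (α : ℝ) (hα : Irrational α) (δ : ℝ) (hδ : 0 < δ) (R : ℕ) (hR : 1 ≤ R) :
    ∃ κ : ℝ, 0 < κ ∧ ∃ X0 : ℕ, ∀ k, X0 ≤ k → 1 ≤ k → ∀ (q : ℕ) (S : Finset ℕ),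
      (∀ p ∈ S, p ∈ vQ k ∧ ∃ r : ℕ, 1 ≤ r ∧ r ≤ R ∧ vnn (α * r * p - α * r * q) < κ) → (S.card : ℝ) ≤ δ * (2 ^ k / k) := by
  have hR0 : (0 : ℝ) < R := by exact_mod_cast hR
  have hbt := fun r : ℕ => v_BT (α * ((r + 1 : ℕ) : ℝ)) (hα.mul_natCast (by omega)) (δ / (2 * R)) (by positivity)
  choose κ hκ X0 hX0 using hbt
  obtain ⟨r0, hr0, hmin⟩ := Finset.exists_min_image (range R) κ ⟨0, by rw [mem_range]; omega⟩
  refine ⟨κ r0, hκ r0, ∑ r ∈ range R, X0 r, ?_⟩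
  intro k hk hk1 q S hS
  have hk0 : (0 : ℝ) < k := by exact_mod_cast hk1
  have hsub : S ⊆ (range R).biUnion (fun r => (Ioc 0 (2 ^ (k + 1))).filter (fun p : ℕ => p.Prime ∧ vnn (α * ((r + 1 : ℕ) : ℝ) * p - α * ((r + 1 : ℕ) : ℝ) * q) ≤ κ r)) := by
    intro p hp
    obtain ⟨h1, r, hr1, hr2, hr3⟩ := hS p hp
    simp only [vQ, mem_filter, mem_Ico] at h1
    rw [mem_biUnion]
    refine ⟨r - 1, by rw [mem_range]; omega, ?_⟩
    rw [mem_filter, mem_Ioc]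
    refine ⟨⟨h1.2.pos, h1.1.2.le⟩, h1.2, ?_⟩
    rw [Nat.sub_add_cancel hr1]
    exact hr3.le.trans (hmin (r - 1) (by rw [mem_range]; omega))
  have hc := (Finset.card_le_card hsub).trans Finset.card_biUnion_le
  have hc' : (S.card : ℝ) ≤ ∑ r ∈ range R, (((Ioc 0 (2 ^ (k + 1))).filter (fun p : ℕ => p.Prime ∧ vnn (α * ((r + 1 : ℕ) : ℝ) * p - α * ((r + 1 : ℕ) : ℝ) * q) ≤ κ r)).card : ℝ) := by
    exact_mod_cast hc
  refine hc'.trans ?_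
  have hb : ∀ r ∈ range R, (((Ioc 0 (2 ^ (k + 1))).filter (fun p : ℕ => p.Prime ∧ vnn (α * ((r + 1 : ℕ) : ℝ) * p - α * ((r + 1 : ℕ) : ℝ) * q) ≤ κ r)).card : ℝ) ≤ (δ / R) * (2 ^ k / k) := by
    intro r hr
    have h1 : X0 r ≤ 2 ^ (k + 1) := by
      have h2 : X0 r ≤ ∑ r ∈ range R, X0 r := Finset.single_le_sum (f := X0) (fun _ _ => Nat.zero_le _) hr
      have h3 : k + 1 < 2 ^ (k + 1) := Nat.lt_two_pow_self
      omega
    refine (hX0 r _ h1 _).trans ?_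
    rw [Nat.log_pow (by norm_num)]
    push_cast
    rw [show δ / (2 * R) * 2 ^ (k + 1) / ((k : ℝ) + 1) = (δ / R) * (2 ^ k / (k + 1)) by rw [pow_succ]; field_simp]
    gcongr
    linarith
  refine (Finset.sum_le_sum hb).trans (le_of_eq ?_)
  rw [Finset.sum_const, card_range, nsmul_eq_mul]
  field_simp

lemma v_typeI (J s L : ℕ) (hs : vE / 4 ^ s ≤ 1) (hL : 1 ≤ L) (α : ℝ)
    (hγ : ∀ r : ℕ, 1 ≤ r → r ≤ L.factorial → 1 / (2 * (vDD J s : ℝ)) ≤ vnn (α * r)) (N : ℕ) [DecidablePred (vrough J)] :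
    ‖∑ n ∈ Ioc 0 N, (if vrough J n then ve (α * (n : ℕ)) else 0)‖ ≤
      (vE / L) * (6 * N / 2 ^ J) + 3 * (vDD J s : ℝ) ^ 2 + ((vE / 4 ^ s) * (6 * N / 2 ^ J) + J * vDD J s) := by
  have e : ∑ n ∈ Ioc 0 N, (if vrough J n then ve (α * (n : ℕ)) else 0) =
     ∑ n ∈ Ioc 0 N, (vw J s n : ℂ) * ve (α * (n : ℕ)) - ∑ n ∈ Ioc 0 N, ((vw J s n - if vrough J n then 1 else 0 : ℝ) : ℂ) * ve (α * (n : ℕ)) := by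
    rw [← Finset.sum_sub_distrib]
    apply Finset.sum_congr rfl
    intro n _
    split_ifs <;> push_cast <;> ring
  rw [e]
  refine (norm_sub_le _ _).trans (add_le_add (vW4 J s L hs hL α hγ N) ?_)
  refine le_trans ?_ (vw_sub J s hs N)
  refine (norm_sum_le _ _).trans (Finset.sum_le_sum ?_)
  intro n _
  rw [norm_mul, ve_norm, mul_one, Complex.norm_real, Real.norm_eq_abs, abs_of_nonneg]
  exact sub_nonneg.2 (vw_ge J s n)

lemma v_choose_s (ε : ℝ) (hε : 0 < ε) : ∃ s : ℕ, vE / 4 ^ s ≤ 1 ∧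
    6 * (vE / 4 ^ s) ≤ (ε / (2 * (10 * (4 * s + 6)))) / 8 := by
  have hE := vE_pos
  obtain ⟨s, hs⟩ := pow_unbounded_of_one_lt (max vE (9600 * vE / ε)) (show (1 : ℝ) < 2 by norm_num)
  have h1 : vE ≤ 2 ^ s := ((le_max_left _ _).trans_lt hs).le
  have h2 : 9600 * vE / ε ≤ 2 ^ s := ((le_max_right _ _).trans_lt hs).le
  rw [div_le_iff₀ hε] at h2
  have h4 : (4 : ℝ) ^ s = 2 ^ s * 2 ^ s := by rw [← mul_pow]; norm_num
  have h5 : (1 : ℝ) ≤ 2 ^ s := one_le_pow₀ (by norm_num)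
  have h6 : (s : ℝ) ≤ 2 ^ s := by exact_mod_cast (Nat.lt_two_pow_self (n := s)).le
  have h7 : (0 : ℝ) ≤ s := by positivity
  refine ⟨s, ?_, ?_⟩
  · rw [div_le_one (by positivity), h4]; nlinarith
  · rw [div_div, ← mul_div_assoc, div_le_div_iff₀ (by positivity) (by positivity), h4]
    calc 6 * vE * (2 * (10 * (4 * s + 6)) * 8) = 960 * vE * (4 * s + 6) := by ring
      _ ≤ 960 * vE * (10 * 2 ^ s) := by gcongr; linarith
      _ = (9600 * vE) * 2 ^ s := by ring
      _ ≤ (2 ^ s * ε) * 2 ^ s := by gcongr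
      _ = _ := by ring

set_option maxHeartbeats 1000000 in
theorem v_main (α : ℝ) (hα : Irrational α) (ε : ℝ) (hε : 0 < ε) : ∃ N0 : ℕ, ∀ N ≥ N0,
    ‖∑ n ∈ (Ioc 0 N).filter Nat.Prime, ve (α * (n : ℕ))‖ ≤ ε * N / Nat.log 2 N := by
  classical
  have hE := vE_pos
  obtain ⟨s, hs, hs2⟩ := v_choose_s ε hε
  set A : ℝ := 2 * (10 * (4 * s + 6)) with hA
  have hA0 : 0 < A := by positivity
  set ε' := ε / A with hε'
  have hε'0 : 0 < ε' := by positivity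
  set η := ε' / (8 * A) with hη
  have hη0 : 0 < η := by positivity
  set δ := η ^ 2 / 392 with hδ
  have hδ0 : 0 < δ := by positivity
  obtain ⟨L, hL⟩ := exists_nat_gt (max 1 (max (48 * vE / ε') (224 * (6 * vE + 1) / η ^ 2)))
  have hL1 : (1 : ℝ) < L := lt_of_le_of_lt (le_max_left _ _) hL
  have hL1n : 1 ≤ L := by exact_mod_cast hL1.le
  have hL0 : (0 : ℝ) < L := by linarith
  have hL2 : 48 * vE ≤ ε' * L := by
    have := lt_of_le_of_lt ((le_max_left _ _).trans (le_max_right _ _)) hL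
    rw [div_lt_iff₀ hε'0] at this
    linarith
  have hL3 : 224 * (6 * vE + 1) ≤ η ^ 2 * L := by
    have := lt_of_le_of_lt ((le_max_right _ _).trans (le_max_right _ _)) hL
    rw [div_lt_iff₀ (by positivity)] at this
    linarith
  obtain ⟨c, hc0, hc⟩ := v_irr α hα L.factorial
  obtain ⟨κ, hκ0, X0, hX0⟩ := v_BTR α hα δ hδ0 L.factorial (Nat.factorial_pos _)
  obtain ⟨C, hC⟩ := exists_nat_gt (max (max (32 / ε') (3 * L)) (max (1 / (2 * c)) (max (1 / (2 * κ)) X0)))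
  have hC1 : 32 / ε' ≤ C := (((le_max_left _ _).trans (le_max_left _ _)).trans_lt hC).le
  have hC2 : (3 * L : ℝ) ≤ C := (((le_max_right _ _).trans (le_max_left _ _)).trans_lt hC).le
  have hC3 : 1 / (2 * c) ≤ C := (((le_max_left _ _).trans (le_max_right _ _)).trans_lt hC).le
  have hC4 : 1 / (2 * κ) ≤ C := (((le_max_left _ _).trans ((le_max_right _ _).trans (le_max_right _ _))).trans_lt hC).le
  have hC5 : (X0 : ℝ) ≤ C := (((le_max_right _ _).trans ((le_max_right _ _).trans (le_max_right _ _))).trans_lt hC).le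
  have hC5n : X0 ≤ C := by exact_mod_cast hC5
  obtain ⟨N0, hN0⟩ := v_par s C
  refine ⟨N0 + 16, fun N hN => ?_⟩
  obtain ⟨J, hCJ, hJ1, hJlog, hlog, hD10, hzD, hJD, hCD, hJD2⟩ := hN0 N (by omega)
  have hDdef : vDD J s = vDD J s := rfl
  set D := vDD J s with hD
  have hD1n : 1 ≤ D := vDD_pos J s
  have hD1 : (1 : ℝ) ≤ D := by exact_mod_cast hD1n
  have hCD' : (C : ℝ) ≤ D := by exact_mod_cast hCD
  have hJD2' : (J : ℝ) ≤ D := by exact_mod_cast hJD2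
  set n2 := Nat.log 2 N with hn2
  have hn2' : 4 ≤ n2 := Nat.le_log_of_pow_le (by norm_num) (by omega)
  set K0 := n2 / 2 + 1 with hK0
  set y := 2 ^ (n2 / 2) with hy
  have hyN : y ^ 2 ≤ N := by
    calc y ^ 2 = 2 ^ (n2 / 2 * 2) := by rw [hy, ← pow_mul]
      _ ≤ 2 ^ n2 := Nat.pow_le_pow_right (by norm_num) (by omega)
      _ ≤ N := Nat.pow_log_le_self 2 (by omega)
  have hNY : N < (2 ^ K0) ^ 2 := by
    calc N < 2 ^ (n2 + 1) := Nat.lt_pow_succ_log_self (by norm_num) _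
      _ ≤ 2 ^ (K0 * 2) := Nat.pow_le_pow_right (by norm_num) (by omega)
      _ = _ := by rw [pow_mul]
  have hY : 2 ^ K0 = 2 * y := by rw [hK0, hy, pow_succ]; ring
  have hD2 : 2 ≤ D := by
    have : 2 ^ 1 ≤ 2 ^ J := Nat.pow_le_pow_right (by norm_num) hJ1
    omega
  have hD4 : D ^ 4 ≤ y := by
    have h1 : (D ^ 5) ^ 2 < (2 * y) ^ 2 := by
      rw [← pow_mul, ← hY]; exact lt_of_le_of_lt hD10 hNY
    have h2 : D ^ 5 < 2 * y := lt_of_pow_lt_pow_left₀ 2 (by positivity) h1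
    have h3 : D ^ 4 * 2 ≤ D ^ 5 := by rw [pow_succ D 4]; exact Nat.mul_le_mul_left _ hD2
    omega
  have hyNle : y ≤ N := le_trans (Nat.le_self_pow (by norm_num) y) hyN
  have hJK : 2 ^ J ≤ K0 := by
    have : 2 ^ J * 2 ≤ 2 ^ J * (10 * (4 * s + 6)) := Nat.mul_le_mul_left _ (by omega)
    omega
  set U : ℝ := N / 2 ^ J with hU
  have hU0 : 0 ≤ U := by positivity
  have eU : 6 * (N : ℝ) / 2 ^ J = 6 * U := by rw [hU]; ring
  -- type I
  have hT1 := v_typeI J s L hs hL1n α (by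
    intro r hr1 hr2
    have h5 := hc (r : ℤ) (by omega) (by rw [abs_of_nonneg (by positivity)]; exact_mod_cast hr2)
    have h6 : 1 / (2 * (D : ℝ)) ≤ c := by
      rw [div_le_iff₀ (by positivity)]
      rw [div_le_iff₀ (by positivity)] at hC3
      nlinarith
    exact h6.trans (by exact_mod_cast h5)) N
  rw [eU] at hT1
  have hT1a : (vE / L) * (6 * U) ≤ ε' / 8 * U := by
    have : vE / L * 6 ≤ ε' / 8 := by
      rw [div_mul_eq_mul_div, div_le_iff₀ hL0]; linarith
    calc (vE / L) * (6 * U) = (vE / L * 6) * U := by ring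
      _ ≤ _ := by gcongr
  have hT1b : (vE / 4 ^ s) * (6 * U) ≤ ε' / 8 * U := by
    calc (vE / 4 ^ s) * (6 * U) = (6 * (vE / 4 ^ s)) * U := by ring
      _ ≤ _ := by gcongr
  have hT1c : 3 * (D : ℝ) ^ 2 + J * D ≤ ε' / 8 * U := by
    have h1 : 32 / ε' * (D : ℝ) ^ 2 ≤ U := v_small J D N _ hJD (hC1.trans hCD') (hD4.trans hyNle)
    have h2 : 3 * (D : ℝ) ^ 2 + J * D ≤ 4 * (D : ℝ) ^ 2 := by nlinarith
    have h3 : ε' / 8 * (32 / ε' * (D : ℝ) ^ 2) = 4 * (D : ℝ) ^ 2 := by field_simp; norm_num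
    have h4 := mul_le_mul_of_nonneg_left h1 (show 0 ≤ ε' / 8 by positivity)
    linarith
  -- blocks
  have hblk : ∀ k ∈ Ico (2 ^ J) K0, ‖∑ p ∈ vQ k, ∑ m ∈ Ioc 0 (N / p), (vb J K0 m : ℂ) * ve (α * (p : ℕ) * (m : ℕ))‖ ≤ η * (U / 2 ^ J) := by
    intro k hk
    rw [mem_Ico] at hk
    have hJp : J < 2 ^ J := Nat.lt_two_pow_self
    have hk1 : 1 ≤ k := by omega
    have hMy : y ≤ N / 2 ^ k := by
      rw [Nat.le_div_iff_mul_le (by positivity)]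
      have : 2 ^ k ≤ y := Nat.pow_le_pow_right (by norm_num) (by omega)
      nlinarith
    have hb := v_block J s L hs hL1n α δ N k hk1 (vb J K0) (fun m => vb_le J K0 s m)
      (v_small J D _ _ hJD (hC2.trans hCD') (hD4.trans hMy)) (by
        intro q S hS
        apply hX0 k (by omega) hk1 q S
        intro p hp
        obtain ⟨h1, r, h2, h3, h4⟩ := hS p hp
        refine ⟨h1, r, h2, h3, lt_of_lt_of_le h4 ?_⟩
        rw [div_le_iff₀ (by positivity)]
        rw [div_le_iff₀ (by positivity)] at hC4
        nlinarith)
    have hcoef : 7 * (16 * (6 * vE + 1) / L + 28 * δ) ≤ η ^ 2 := by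
      have h1 : 16 * (6 * vE + 1) / L ≤ η ^ 2 / 14 := by
        rw [div_le_div_iff₀ hL0 (by norm_num)]; linarith
      rw [hδ]; linarith
    have hGU : (2 ^ k / (k : ℝ)) * (((N / 2 ^ k : ℕ) : ℝ) / 2 ^ J) ≤ U / 2 ^ J := by
      have h1 : ((N / 2 ^ k : ℕ) : ℝ) ≤ N / 2 ^ k := by
        refine Nat.cast_div_le.trans (le_of_eq ?_); push_cast; rfl
      have h2 : (2 : ℝ) ^ J ≤ k := by exact_mod_cast hk.1
      calc (2 ^ k / (k : ℝ)) * (((N / 2 ^ k : ℕ) : ℝ) / 2 ^ J) ≤ (2 ^ k / 2 ^ J) * ((N / 2 ^ k) / 2 ^ J) := by gcongr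
        _ = U / 2 ^ J := by rw [hU]; field_simp
    apply le_of_sq_le_sq _ (by positivity)
    refine hb.trans ?_
    calc _ ≤ η ^ 2 * (U / 2 ^ J) ^ 2 := mul_le_mul hcoef (pow_le_pow_left₀ (by positivity) hGU 2) (by positivity) (by positivity)
      _ = (η * (U / 2 ^ J)) ^ 2 := by ring
  have hT2 : ∑ k ∈ Ico (2 ^ J) K0, ‖∑ p ∈ vQ k, ∑ m ∈ Ioc 0 (N / p), (vb J K0 m : ℂ) * ve (α * (p : ℕ) * (m : ℕ))‖ ≤ ε' / 8 * U := by
    refine (Finset.sum_le_sum hblk).trans ?_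
    rw [Finset.sum_const, Nat.card_Ico, nsmul_eq_mul]
    have h1 : ((K0 - 2 ^ J : ℕ) : ℝ) ≤ A * 2 ^ J := by
      have : K0 - 2 ^ J ≤ 2 * (10 * (4 * s + 6)) * 2 ^ J := ((Nat.sub_le _ _).trans (show K0 ≤ n2 by omega)).trans hlog
      rw [hA]; exact_mod_cast this
    calc ((K0 - 2 ^ J : ℕ) : ℝ) * (η * (U / 2 ^ J)) ≤ (A * 2 ^ J) * (η * (U / 2 ^ J)) := by gcongr
      _ = ε' / 8 * U := by rw [hη]; field_simp
  -- remaining small terms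
  have hT3 : (2 : ℝ) ^ K0 ≤ ε' / 8 * U := by
    have h1 : 16 / ε' * 2 ^ J ≤ y := by
      have a1 : (2 : ℝ) ^ J ≤ D := by exact_mod_cast hJD
      have a2 : (D : ℝ) ^ 4 ≤ y := by exact_mod_cast hD4
      have a3 : 16 / ε' ≤ D := by
        have : 16 / ε' ≤ 32 / ε' := by gcongr; norm_num
        linarith
      have a4 : (D : ℝ) ^ 2 ≤ D ^ 4 := pow_le_pow_right₀ hD1 (by norm_num)
      calc 16 / ε' * 2 ^ J ≤ D * D := by gcongr
        _ = D ^ 2 := by ring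
        _ ≤ y := by linarith
    have h2 : (2 : ℝ) ^ K0 = 2 * y := by exact_mod_cast hY
    have h3 : (y : ℝ) ^ 2 ≤ N := by exact_mod_cast hyN
    rw [h2, hU, ← mul_div_assoc, le_div_iff₀ (by positivity)]
    have h4 : (ε' / 8) * (16 / ε' * 2 ^ J * y) ≤ (ε' / 8) * N := by
      apply mul_le_mul_of_nonneg_left _ (by positivity)
      calc 16 / ε' * 2 ^ J * y ≤ y * y := by gcongr
        _ ≤ N := by linarith
    have h5 : (ε' / 8) * (16 / ε' * 2 ^ J * y) = 2 * y * 2 ^ J := by field_simp; ring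
    linarith
  have hT4 : 2 * (N : ℝ) / 2 ^ (2 ^ J) ≤ ε' / 8 * U := by
    have h1 : 16 / ε' * 2 ^ J ≤ (2 : ℝ) ^ (2 ^ J) := by
      have b1 : J * 2 ^ J ≤ 2 ^ (2 ^ J) := by
        have c1 : J < 2 ^ J := Nat.lt_two_pow_self
        have c2 : J * 2 ≤ 2 ^ J := by
          have : J - 1 < 2 ^ (J - 1) := Nat.lt_two_pow_self
          have e : 2 ^ J = 2 ^ (J - 1) * 2 := by rw [← pow_succ]; congr 1; omega
          omega
        calc J * 2 ^ J ≤ 2 ^ J * 2 ^ J := Nat.mul_le_mul_right _ c1.le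
          _ = 2 ^ (J * 2) := by rw [pow_mul]; ring
          _ ≤ _ := Nat.pow_le_pow_right (by norm_num) c2
      have b2 : (J : ℝ) * 2 ^ J ≤ (2 : ℝ) ^ (2 ^ J) := by exact_mod_cast b1
      have b3 : (C : ℝ) ≤ J := by exact_mod_cast hCJ
      have b4 : 16 / ε' ≤ J := by
        have : 16 / ε' ≤ 32 / ε' := by gcongr; norm_num
        linarith
      refine le_trans ?_ b2
      gcongr
    rw [hU, ← mul_div_assoc, div_le_div_iff₀ (by positivity) (by positivity)]
    have h4 := mul_le_mul_of_nonneg_left h1 (show (0 : ℝ) ≤ ε' / 8 * N by positivity)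
    have h5 : ε' / 8 * N * (16 / ε' * 2 ^ J) = 2 * N * 2 ^ J := by field_simp; ring
    linarith
  have htot := v_buchstab J K0 N α hJK hNY
  have hfin : ‖∑ n ∈ (Ioc 0 N).filter Nat.Prime, ve (α * (n : ℕ))‖ ≤ ε' * U := by
    have : 0 ≤ ε' * U := by positivity
    linarith
  refine hfin.trans ?_
  have hlog0 : (0 : ℝ) < n2 := by exact_mod_cast (by omega : 0 < n2)
  rw [le_div_iff₀ hlog0]
  have : (n2 : ℝ) ≤ A * 2 ^ J := by rw [hA]; exact_mod_cast hlog
  calc ε' * U * n2 ≤ ε' * U * (A * 2 ^ J) := by gcongr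
    _ = ε * N := by rw [hε', hU]; field_simp


lemma v_cheb (M : ℕ) (hM : 6 ≤ M) : (M : ℝ) / Nat.log 2 M ≤ 4 * (Nat.primeCounting M : ℝ) := by
  have h1 := Chebyshev.pi_ge M
  have h2 : (M + 1) ^ 2 ≤ 2 ^ M := by
    induction M, hM using Nat.le_induction with
    | base => norm_num
    | succ n hn ih =>
      have := ih (Chebyshev.pi_ge n)
      rw [pow_succ 2 n]
      nlinarith
  have hM0 : (6 : ℝ) ≤ M := by exact_mod_cast hM
  have hlM : 0 < Real.log M := Real.log_pos (by linarith)
  have hl2 : 0 < Real.log 2 := Real.log_pos (by norm_num)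
  have h3 : 2 * Real.log (M + 1) ≤ M * Real.log 2 := by
    have : ((M : ℝ) + 1) ^ 2 ≤ 2 ^ M := by exact_mod_cast h2
    have := Real.log_le_log (by positivity) this
    rw [Real.log_pow, Real.log_pow] at this
    exact_mod_cast this
  have h4 : Real.log M ≤ 2 * (Nat.log 2 M : ℝ) * Real.log 2 := by
    have a : M < 2 ^ (Nat.log 2 M + 1) := Nat.lt_pow_succ_log_self (by norm_num) _
    have a' : (M : ℝ) ≤ 2 ^ (Nat.log 2 M + 1) := by exact_mod_cast a.le
    have b : 1 ≤ Nat.log 2 M := Nat.le_log_of_pow_le (by norm_num) (by omega)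
    have b' : (1 : ℝ) ≤ Nat.log 2 M := by exact_mod_cast b
    have := Real.log_le_log (by positivity) a'
    rw [Real.log_pow] at this
    push_cast at this
    nlinarith
  have h5 : 0 < (Nat.log 2 M : ℝ) := by
    by_contra h
    push Not at h
    nlinarith
  rw [div_le_iff₀ hlM] at h1
  rw [div_le_iff₀ h5]
  have hp : (0 : ℝ) ≤ Nat.primeCounting M := by positivity
  have h6 : (Nat.primeCounting M : ℝ) * Real.log M ≤ (Nat.primeCounting M : ℝ) * (2 * (Nat.log 2 M : ℝ) * Real.log 2) := by gcongr
  have h7 : M * Real.log 2 ≤ (4 * (Nat.primeCounting M : ℝ) * Nat.log 2 M) * Real.log 2 := by nlinarith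
  exact le_of_mul_le_mul_right h7 hl2

lemma v_nth_sum (f : ℕ → ℂ) (N : ℕ) :
    ∑ i ∈ range (N + 1), f (Nat.nth Nat.Prime i) = ∑ n ∈ (Ioc 0 (Nat.nth Nat.Prime N)).filter Nat.Prime, f n := by
  refine Finset.sum_bij (fun i _ => Nat.nth Nat.Prime i) ?_ ?_ ?_ ?_
  · intro i hi
    have hp := Nat.prime_nth_prime i
    rw [mem_range] at hi
    simp only [mem_filter, mem_Ioc]
    exact ⟨⟨hp.pos, (Nat.nth_le_nth Nat.infinite_setOf_prime).2 (by omega)⟩, hp⟩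
  · intro a _ b _ h
    exact Nat.nth_injective Nat.infinite_setOf_prime h
  · intro p hp
    simp only [mem_filter, mem_Ioc] at hp
    refine ⟨Nat.count Nat.Prime p, ?_, Nat.nth_count hp.2⟩
    rw [mem_range, Nat.lt_succ_iff]
    rw [← Nat.nth_le_nth Nat.infinite_setOf_prime, Nat.nth_count hp.2]
    exact hp.1.2
  · intro i _; rfl

lemma v_prime_avg (α : ℝ) (hα : Irrational α) :
    Filter.Tendsto (fun N : ℕ => (∑ i ∈ range (N + 1), ve (α * (Nat.nth Nat.Prime i : ℕ))) / ((N : ℂ) + 1))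
      Filter.atTop (nhds 0) := by
  rw [Metric.tendsto_atTop]
  intro ε hε
  obtain ⟨N0, hN0⟩ := v_main α hα (ε / 8) (by positivity)
  refine ⟨N0 + 6, fun N hN => ?_⟩
  rw [dist_zero_right, norm_div]
  set M := Nat.nth Nat.Prime N with hM
  have hMN : N + 2 ≤ M := Nat.add_two_le_nth_prime N
  have h1 := hN0 M (by omega)
  have h2 := v_cheb M (by omega)
  have h3 : Nat.primeCounting M = N + 1 := by
    rw [Nat.primeCounting, Nat.primeCounting', Nat.count_succ, hM, Nat.count_nth_of_infinite Nat.infinite_setOf_prime,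
      if_pos (Nat.prime_nth_prime N)]
  rw [h3] at h2
  have h4 := v_nth_sum (fun n => ve (α * (n : ℕ))) N
  rw [← hM] at h4
  rw [h4]
  have h5 : ‖(N : ℂ) + 1‖ = (N : ℝ) + 1 := by
    have : (N : ℂ) + 1 = ((N + 1 : ℕ) : ℂ) := by push_cast; rfl
    rw [this, Complex.norm_natCast]; push_cast; rfl
  rw [h5, div_lt_iff₀ (by positivity)]
  refine lt_of_le_of_lt h1 ?_
  push_cast at h2
  rw [mul_div_assoc]
  have : ε / 8 * ((M : ℝ) / Nat.log 2 M) ≤ ε / 8 * (4 * (N + 1)) := by gcongr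
  have : 0 < ε * (N + 1) := by positivity
  linarith

open MeasureTheory

lemma v_avg_cont (u : ℕ → ℝ)
    (H : ∀ k : ℤ, k ≠ 0 → Filter.Tendsto (fun N : ℕ => (∑ i ∈ range (N + 1), ve (k * u i)) / ((N : ℂ) + 1))
      Filter.atTop (nhds 0)) (f : C(UnitAddCircle, ℂ)) :
    Filter.Tendsto (fun N : ℕ => (∑ i ∈ range (N + 1), f (u i : UnitAddCircle)) / ((N : ℂ) + 1))
      Filter.atTop (nhds (∫ x, f x ∂AddCircle.haarAddCircle)) := by
  have hint : ∀ f : C(UnitAddCircle, ℂ), Integrable f (AddCircle.haarAddCircle (T := 1)) := fun f =>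
    f.continuous.integrable_of_hasCompactSupport (HasCompactSupport.of_compactSpace f)
  have hN0 : ∀ N : ℕ, (N : ℂ) + 1 ≠ 0 := fun N => by exact_mod_cast Nat.succ_ne_zero N
  have hspan : ∀ g ∈ Submodule.span ℂ (Set.range (@fourier 1)),
      Filter.Tendsto (fun N : ℕ => (∑ i ∈ range (N + 1), g (u i : UnitAddCircle)) / ((N : ℂ) + 1))
      Filter.atTop (nhds (∫ x, g x ∂AddCircle.haarAddCircle)) := by
    intro g hg
    induction hg using Submodule.span_induction with
    | mem x hx =>
      obtain ⟨k, rfl⟩ := hx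
      by_cases hk : k = 0
      · subst hk
        simp only [fourier_zero]
        refine tendsto_const_nhds.congr' ?_
        filter_upwards with N
        simp
        field_simp [hN0 N]
      · have : ∫ x, fourier k x ∂(AddCircle.haarAddCircle (T := 1)) = 0 :=
          integral_eq_zero_of_add_right_eq_neg (fourier_add_half_inv_index hk one_pos)
        rw [this]
        refine (H k hk).congr ?_
        intro N
        congr 1
        refine Finset.sum_congr rfl fun i _ => ?_
        rw [fourier_coe_apply, ve]
        congr 1
        push_cast
        ring
    | zero => simp
    | add x y _ _ hx hy =>
      simp only [ContinuousMap.add_apply, Finset.sum_add_distrib, add_div]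
      rw [integral_add (hint x) (hint y)]
      exact hx.add hy
    | smul c x _ hx =>
      simp only [ContinuousMap.smul_apply, smul_eq_mul, ← Finset.mul_sum, mul_div_assoc]
      rw [integral_const_mul]
      exact hx.const_mul c
  rw [Metric.tendsto_atTop]
  intro ε hε
  have hf : f ∈ (Submodule.span ℂ (Set.range (@fourier 1))).topologicalClosure := by
    rw [span_fourier_closure_eq_top]; trivial
  rw [← SetLike.mem_coe, Submodule.topologicalClosure_coe, Metric.mem_closure_iff] at hf
  obtain ⟨g, hg, hfg⟩ := hf (ε / 3) (by positivity)
  have hpt : ∀ x, ‖f x - g x‖ ≤ ε / 3 := fun x => by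
    rw [← dist_eq_norm]; exact (ContinuousMap.dist_apply_le_dist x).trans hfg.le
  obtain ⟨N0, hN⟩ := Metric.tendsto_atTop.1 (hspan g hg) (ε / 3) (by positivity)
  refine ⟨N0, fun N h => ?_⟩
  have h1 := hN N h
  rw [dist_eq_norm] at h1 ⊢
  have hnn : ‖(N : ℂ) + 1‖ = (N : ℝ) + 1 := by
    have : (N : ℂ) + 1 = ((N + 1 : ℕ) : ℂ) := by push_cast; rfl
    rw [this, Complex.norm_natCast]; push_cast; rfl
  have h2 : ‖(∑ i ∈ range (N + 1), f (u i : UnitAddCircle)) / ((N : ℂ) + 1) - (∑ i ∈ range (N + 1), g (u i : UnitAddCircle)) / ((N : ℂ) + 1)‖ ≤ ε / 3 := by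
    rw [← sub_div, ← Finset.sum_sub_distrib, norm_div, hnn, div_le_iff₀ (by positivity)]
    refine (norm_sum_le _ _).trans ((Finset.sum_le_sum fun i _ => hpt _).trans ?_)
    simp; linarith
  have h3 : ‖∫ x, g x ∂(AddCircle.haarAddCircle (T := 1)) - ∫ x, f x ∂(AddCircle.haarAddCircle (T := 1))‖ ≤ ε / 3 := by
    rw [← integral_sub (hint g) (hint f)]
    have := norm_integral_le_of_norm_le_const (μ := AddCircle.haarAddCircle (T := 1)) (f := fun x => g x - f x) (C := ε / 3)
      (Filter.Eventually.of_forall fun x => by rw [norm_sub_rev]; exact hpt x)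
    simpa using this
  have e : ∀ a b c d : ℂ, a - d = (a - b) + (b - c) + (c - d) := by intros; ring
  rw [e _ ((∑ i ∈ range (N + 1), g (u i : UnitAddCircle)) / ((N : ℂ) + 1)) (∫ x, g x ∂(AddCircle.haarAddCircle (T := 1)))]
  have := norm_add₃_le (a := (∑ i ∈ range (N + 1), f (u i : UnitAddCircle)) / ((N : ℂ) + 1) - (∑ i ∈ range (N + 1), g (u i : UnitAddCircle)) / ((N : ℂ) + 1)) (b := (∑ i ∈ range (N + 1), g (u i : UnitAddCircle)) / ((N : ℂ) + 1) - ∫ x, g x ∂(AddCircle.haarAddCircle (T := 1))) (c := ∫ x, g x ∂(AddCircle.haarAddCircle (T := 1)) - ∫ x, f x ∂(AddCircle.haarAddCircle (T := 1)))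
  linarith

lemma v_mem_ball (t x : ℝ) (h0 : 0 ≤ t) (h1 : t < 1) :
    (x : UnitAddCircle) ∈ Metric.closedBall ((t / 2 : ℝ) : UnitAddCircle) (t / 2) ↔ Int.fract x ≤ t := by
  rw [Metric.mem_closedBall, dist_eq_norm, ← AddCircle.coe_sub, UnitAddCircle.norm_eq]
  constructor
  · intro h
    rw [abs_le] at h
    have hx := Int.floor_add_fract x
    have a := Int.fract_nonneg x
    have b := Int.fract_lt_one x
    set m := round (x - t / 2)
    have c1 : ((m - ⌊x⌋ : ℤ) : ℝ) < ((1 : ℤ) : ℝ) := by push_cast; linarith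
    have c2 : ((-1 : ℤ) : ℝ) < ((m - ⌊x⌋ : ℤ) : ℝ) := by push_cast; linarith
    have c1' := Int.cast_lt.1 c1
    have c2' := Int.cast_lt.1 c2
    have : m = ⌊x⌋ := by omega
    rw [this] at h
    linarith
  · intro h
    refine (round_le (x - t / 2) ⌊x⌋).trans ?_
    have a := Int.fract_nonneg x
    have hx := Int.floor_add_fract x
    rw [abs_le]
    constructor <;> linarith

noncomputable def v_meas (u : ℕ → ℝ) (N : ℕ) : Measure UnitAddCircle :=
  ((N : ENNReal) + 1)⁻¹ • ∑ i ∈ range (N + 1), Measure.dirac (u i : UnitAddCircle)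

instance v_meas_prob (u : ℕ → ℝ) (N : ℕ) : IsProbabilityMeasure (v_meas u N) := by
  constructor
  simp [v_meas]
  exact ENNReal.inv_mul_cancel (by simp) (by simp)

lemma v_weyl (u : ℕ → ℝ)
    (H : ∀ k : ℤ, k ≠ 0 → Filter.Tendsto (fun N : ℕ => (∑ i ∈ range (N + 1), ve (k * u i)) / ((N : ℂ) + 1))
      Filter.atTop (nhds 0)) (t : ℝ) (h0 : 0 ≤ t) (h1 : t < 1) :
    Filter.Tendsto (fun N : ℕ => (((range (N + 1)).filter (fun i => Int.fract (u i) ≤ t)).card : ℝ) / ((N : ℝ) + 1))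
      Filter.atTop (nhds t) := by
  have hhv : (AddCircle.haarAddCircle (T := 1)) = volume := by
    rw [AddCircle.volume_eq_smul_haarAddCircle]; simp
  set μ : ProbabilityMeasure UnitAddCircle := ⟨AddCircle.haarAddCircle (T := 1), inferInstance⟩ with hμ
  set μs : ℕ → ProbabilityMeasure UnitAddCircle := fun N => ⟨v_meas u N, inferInstance⟩ with hμs
  have hlim : Filter.Tendsto μs Filter.atTop (nhds μ) := by
    rw [ProbabilityMeasure.tendsto_iff_forall_integral_rclike_tendsto ℂ]
    intro f
    refine (v_avg_cont u H f.toContinuousMap).congr ?_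
    intro N
    simp only [hμs, ProbabilityMeasure.coe_mk, v_meas]
    rw [integral_smul_measure, integral_finsetSum_measure (fun i _ => integrable_dirac (by simp))]
    simp [integral_dirac, div_eq_inv_mul]
    left
    rw [ENNReal.toReal_add (by simp) (by simp)]
    simp
  have key := ProbabilityMeasure.tendsto_measure_of_null_frontier_of_tendsto' hlim
    (E := Metric.closedBall ((t / 2 : ℝ) : UnitAddCircle) (t / 2)) (by
      simp only [hμ, ProbabilityMeasure.coe_mk, hhv]
      have h3 := AddCircle.closedBall_ae_eq_ball (T := 1) (x := ((t / 2 : ℝ) : UnitAddCircle)) (ε := t / 2)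
      refine measure_mono_null ?_ (ae_le_set.1 h3.le)
      rw [frontier, Metric.isClosed_closedBall.closure_eq]
      exact Set.diff_subset_diff_right Metric.ball_subset_interior_closedBall)
  have hE : (μ : Measure UnitAddCircle) (Metric.closedBall ((t / 2 : ℝ) : UnitAddCircle) (t / 2)) = ENNReal.ofReal t := by
    simp only [hμ, ProbabilityMeasure.coe_mk, hhv]
    rw [AddCircle.volume_closedBall]
    congr 1
    rw [min_eq_right] <;> linarith
  rw [hE] at key
  have key2 := (ENNReal.tendsto_toReal ENNReal.ofReal_ne_top).comp key
  rw [ENNReal.toReal_ofReal h0] at key2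
  refine key2.congr ?_
  intro N
  simp only [hμs, ProbabilityMeasure.coe_mk, v_meas, Function.comp]
  rw [Measure.smul_apply, Measure.finsetSum_apply]
  have : ∀ i, (Measure.dirac (u i : UnitAddCircle)) (Metric.closedBall ((t / 2 : ℝ) : UnitAddCircle) (t / 2)) = if Int.fract (u i) ≤ t then 1 else 0 := by
    intro i
    rw [Measure.dirac_apply' _ Metric.isClosed_closedBall.measurableSet]
    by_cases hi : Int.fract (u i) ≤ t
    · rw [if_pos hi, Set.indicator_of_mem ((v_mem_ball t _ h0 h1).2 hi)]; rfl
    · rw [if_neg hi, Set.indicator_of_notMem (fun h => hi ((v_mem_ball t _ h0 h1).1 h))]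
  simp only [this]
  rw [Finset.sum_boole, smul_eq_mul, ENNReal.toReal_mul, ENNReal.toReal_inv, ENNReal.toReal_add (by simp) (by simp)]
  simp [div_eq_inv_mul]

end VinoProof

/-- (Vinogradov) For irrational `α`, the sequence `{α p_n}` is uniformly distributed
modulo 1. -/
theorem vinogradov_ud_mod_one (α : ℝ) (hα : Irrational α) :
    UniformlyDistributedMod1 (fun n : ℕ => α * (nthPrime n : ℝ)) := by
  intro t h0 h1
  have hcard : ∀ (P : ℕ → Prop) [DecidablePred P] (N : ℕ),
      Nat.card {n : ℕ | 1 ≤ n ∧ n ≤ N + 1 ∧ P (n - 1)} = ((Finset.range (N + 1)).filter P).card := by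
    intro P _ N
    rw [← Set.ncard_coe_finset, ← Nat.card_coe_set_eq]
    refine Nat.card_congr ⟨fun n => ⟨n.1 - 1, ?_⟩, fun n => ⟨n.1 + 1, ?_⟩, ?_, ?_⟩
    · obtain ⟨n, a, b, c⟩ := n
      simp only [Finset.coe_filter, Finset.mem_range]
      exact ⟨by omega, c⟩
    · obtain ⟨n, hn⟩ := n
      simp only [Finset.coe_filter, Finset.mem_range] at hn
      exact ⟨by omega, by have := hn.1; show n + 1 ≤ N + 1; omega, by simpa using hn.2⟩
    · rintro ⟨n, a, b, c⟩
      simp only [Subtype.mk.injEq]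
      omega
    · rintro ⟨n, hn⟩
      simp
  rw [← tendsto_add_atTop_iff_nat 1]
  have hmain : Tendsto (fun N : ℕ => (((Finset.range (N + 1)).filter
      (fun i => Int.fract (α * (Nat.nth Nat.Prime i : ℕ)) ≤ t)).card : ℝ) / ((N : ℝ) + 1))
      atTop (nhds t) := by
    rcases h1.lt_or_eq with h1 | h1
    · refine v_weyl (fun i => α * (Nat.nth Nat.Prime i : ℕ)) ?_ t h0 h1
      intro k hk
      refine (v_prime_avg (k * α) (hα.intCast_mul hk)).congr ?_
      intro N
      simp only [mul_assoc]
    · subst h1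
      refine tendsto_const_nhds.congr ?_
      intro N
      rw [Finset.filter_true_of_mem (fun i _ => (Int.fract_lt_one _).le), Finset.card_range]
      push_cast
      rw [div_self (by positivity)]
  refine hmain.congr ?_
  intro N
  rw [← hcard]
  push_cast
  rfl
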